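/- Let g ≥ 3, and let e_g : π₁Σ_g →* π₁Σ_{g−1} be the handle-collapsing homomorphism. Then for every n : ℕ there exists a group automorphism α of π₁Σ_g such that the kernel of e_g ∘ α contains no non-trivial element of Bₙ; that is, for every w ∈ Bₙ with w ≠ 1, one has e_g (α w) ≠ 1. (Lemma 2.29 of the paper, 'lemtechMCG3'.) -/

import Mathlib

/-- The single surface relator `∏ i, [aᵢ, bᵢ]` in the free group on `Fin g ⊕ Fin g`. -/
def surfaceRel (g : ℕ) : Set (FreeGroup (Fin g ⊕ Fin g)) :=
  {(List.ofFn fun i : Fin g =>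
      FreeGroup.of (Sum.inl i) * FreeGroup.of (Sum.inr i) *
        (FreeGroup.of (Sum.inl i))⁻¹ * (FreeGroup.of (Sum.inr i))⁻¹).prod}

/-- The fundamental group of the closed orientable surface of genus `g`. -/
abbrev SurfaceGroup (g : ℕ) : Type := PresentedGroup (surfaceRel g)

/-- The generator `aᵢ` of the surface group. -/
def genA (g : ℕ) (i : Fin g) : SurfaceGroup g := PresentedGroup.of (Sum.inl i)

/-- The generator `bᵢ` of the surface group. -/
def genB (g : ℕ) (i : Fin g) : SurfaceGroup g := PresentedGroup.of (Sum.inr i)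

/-- The standard generators `aᵢ, bᵢ, aᵢ⁻¹, bᵢ⁻¹` of the surface group. -/
def surfaceGens (g : ℕ) : Set (SurfaceGroup g) :=
  {x | ∃ i : Fin g,
    x = genA g i ∨ x = genB g i ∨ x = (genA g i)⁻¹ ∨ x = (genB g i)⁻¹}

/-- The ball `Bₙ` of radius `n` in the surface group for the Cayley metric associated to
the standard generators: elements expressible as products of at most `n` generators or
inverses of generators. -/
def cayleyBall (g n : ℕ) : Set (SurfaceGroup g) :=
  {x | ∃ l : List (SurfaceGroup g),
      l.length ≤ n ∧ (∀ y ∈ l, y ∈ surfaceGens g) ∧ l.prod = x}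

section

open scoped commutatorElement
open Matrix Filter Topology

/-- `x` if the sign is `true`, and `x⁻¹` otherwise. -/
def signed {G : Type*} [Group G] (s : Bool) (x : G) : G := if s then x else x⁻¹

theorem map_signed {G H : Type*} [Group G] [Group H] (φ : G →* H) (s : Bool) (x : G) :
    φ (signed s x) = signed s (φ x) := by
  cases s <;> simp [signed]

/-- An element of `SL(2, ℝ)` is loxodromic if its trace exceeds `2` in absolute value. -/
def IsLoxodromic (A : SpecialLinearGroup (Fin 2) ℝ) : Prop := 2 < |A.1.trace|

theorem IsLoxodromic.ne_one {A : SpecialLinearGroup (Fin 2) ℝ} (h : IsLoxodromic A) : A ≠ 1 := by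
  rintro rfl
  simp [IsLoxodromic] at h

theorem IsLoxodromic.of_isConj {A B : SpecialLinearGroup (Fin 2) ℝ} (h : IsConj A B)
    (hB : IsLoxodromic B) : IsLoxodromic A := by
  obtain ⟨C, rfl⟩ := isConj_iff.1 h
  have : (C * A * C⁻¹).1.trace = A.1.trace := by
    rw [show (C * A * C⁻¹).1 = C.1 * A.1 * C⁻¹.1 from rfl, Matrix.trace_mul_comm,
      ← Matrix.mul_assoc, show C⁻¹.1 * C.1 = (C⁻¹ * C).1 from rfl]
    simp
  rwa [IsLoxodromic, this] at hB

/-- A diagonalization of a matrix with eigenvalues `lam` and `lam⁻¹`: the vectors `v true`,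
`v false` form an eigenbasis with dual basis `f true`, `f false`. -/
structure Eigensystem (A : Matrix (Fin 2) (Fin 2) ℝ) where
  /-- The eigenvalue of largest absolute value. -/
  lam : ℝ
  /-- The eigenvectors. -/
  v : Bool → Fin 2 → ℝ
  /-- The dual basis. -/
  f : Bool → Fin 2 → ℝ
  one_lt : 1 < |lam|
  dual : ∀ s t, f s ⬝ᵥ v t = if s = t then 1 else 0
  sum_eq_one : vecMulVec (v true) (f true) + vecMulVec (v false) (f false) = 1
  eq_sum : A = lam • vecMulVec (v true) (f true) + lam⁻¹ • vecMulVec (v false) (f false)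

theorem exists_eq_vecMulVec_of_det_eq_zero (N : Matrix (Fin 2) (Fin 2) ℝ) (h : N.det = 0) :
    ∃ v f, N = vecMulVec v f := by
  rw [Matrix.det_fin_two] at h
  by_cases ha : N 0 0 = 0
  · rw [ha, zero_mul, zero_sub, neg_eq_zero, mul_eq_zero] at h
    rcases h with h | h
    · refine ⟨![0, 1], ![N 1 0, N 1 1], ?_⟩
      ext i j
      fin_cases i <;> fin_cases j <;> simp [vecMulVec_apply, ha, h]
    · refine ⟨![N 0 1, N 1 1], ![0, 1], ?_⟩
      ext i j
      fin_cases i <;> fin_cases j <;> simp [vecMulVec_apply, ha, h]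
  · refine ⟨![N 0 0, N 1 0], ![1, N 0 1 / N 0 0], ?_⟩
    ext i j
    fin_cases i <;> fin_cases j <;> simp [vecMulVec_apply] <;> field_simp
    linarith

namespace Eigensystem

variable {A : SpecialLinearGroup (Fin 2) ℝ} (E : Eigensystem A.1)


theorem lam_ne_zero : E.lam ≠ 0 := by
  intro h
  have := E.one_lt
  rw [h] at this
  norm_num at this

theorem mul_self (s : Bool) :
    vecMulVec (E.v s) (E.f s) * vecMulVec (E.v s) (E.f s) = vecMulVec (E.v s) (E.f s) := by
  rw [vecMulVec_mul_vecMulVec, E.dual]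
  simp

theorem mul_not (s : Bool) :
    vecMulVec (E.v s) (E.f s) * vecMulVec (E.v !s) (E.f !s) = 0 := by
  rw [vecMulVec_mul_vecMulVec, E.dual]
  cases s <;> simp

theorem signed_eq (s : Bool) :
    (signed s A).1 = E.lam • vecMulVec (E.v s) (E.f s) + E.lam⁻¹ • vecMulVec (E.v !s) (E.f !s) := by
  cases s
  · have h1 := E.mul_self true
    have h2 := E.mul_self false
    have h3 := E.mul_not true
    have h4 := E.mul_not false
    simp only [Bool.not_true, Bool.not_false] at h3 h4
    have key : A.1 * (E.lam • vecMulVec (E.v false) (E.f false) +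
        E.lam⁻¹ • vecMulVec (E.v true) (E.f true)) = 1 := by
      nth_rw 1 [E.eq_sum]
      rw [← E.sum_eq_one]
      simp only [add_mul, mul_add, smul_mul_smul_comm, h1, h2, h3, h4]
      simp [E.lam_ne_zero, add_comm]
    have hA : A⁻¹.1 * A.1 = 1 := by
      rw [show A⁻¹.1 * A.1 = (A⁻¹ * A).1 from rfl]
      simp
    calc A⁻¹.1 = A⁻¹.1 * (A.1 * _) := by rw [key, mul_one]
      _ = _ := by rw [← mul_assoc, hA, one_mul]; rfl
  · exact E.eq_sum

theorem signed_pow_eq (s : Bool) (k : ℕ) :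
    ((signed s A) ^ k).1 =
      E.lam ^ k • vecMulVec (E.v s) (E.f s) + E.lam⁻¹ ^ k • vecMulVec (E.v !s) (E.f !s) := by
  have h1 := E.mul_self s
  have h2 := E.mul_self !s
  have h3 := E.mul_not s
  have h4 := E.mul_not !s
  rw [Bool.not_not] at h4
  induction k with
  | zero =>
    have := E.sum_eq_one
    cases s
    · rw [add_comm] at this
      simpa using this.symm
    · simpa using this.symm
  | succ k ih =>
    rw [pow_succ, show (signed s A ^ k * signed s A).1 = (signed s A ^ k).1 * (signed s A).1 from rfl,
      ih, E.signed_eq s]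
    simp only [add_mul, mul_add, smul_mul_smul_comm, h1, h2, h3, h4, pow_succ]
    simp

theorem tendsto_signed_pow (s : Bool) :
    Tendsto (fun k : ℕ => E.lam⁻¹ ^ k • ((signed s A) ^ k).1) atTop
      (𝓝 (vecMulVec (E.v s) (E.f s))) := by
  have h0 : |E.lam⁻¹ * E.lam⁻¹| < 1 := by
    have := E.one_lt
    rw [abs_mul, abs_inv]
    have h : |E.lam|⁻¹ < 1 := inv_lt_one_of_one_lt₀ this
    have h' : 0 ≤ |E.lam|⁻¹ := by positivity
    nlinarith
  have h1 := (tendsto_pow_atTop_nhds_zero_of_abs_lt_one h0).smul_const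
    (vecMulVec (E.v !s) (E.f !s))
  have h2 := h1.const_add (vecMulVec (E.v s) (E.f s))
  rw [zero_smul, add_zero] at h2
  refine h2.congr fun k => ?_
  rw [E.signed_pow_eq, smul_add, smul_smul, smul_smul, ← mul_pow, inv_mul_cancel₀ E.lam_ne_zero,
    one_pow, one_smul, mul_pow]

theorem tendsto_lam_inv_pow : Tendsto (fun k : ℕ => E.lam⁻¹ ^ k) atTop (𝓝 0) := by
  apply tendsto_pow_atTop_nhds_zero_of_abs_lt_one
  rw [abs_inv]
  exact inv_lt_one_of_one_lt₀ E.one_lt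

theorem mulVec_v (s : Bool) : ∃ μ : ℝ, μ ≠ 0 ∧ A.1 *ᵥ E.v s = μ • E.v s := by
  cases s
  · refine ⟨E.lam⁻¹, inv_ne_zero E.lam_ne_zero, ?_⟩
    refine (congrArg (· *ᵥ E.v false) E.eq_sum).trans ?_
    rw [add_mulVec, smul_mulVec, smul_mulVec, vecMulVec_mulVec, vecMulVec_mulVec, E.dual, E.dual]
    simp
  · refine ⟨E.lam, E.lam_ne_zero, ?_⟩
    refine (congrArg (· *ᵥ E.v true) E.eq_sum).trans ?_
    rw [add_mulVec, smul_mulVec, smul_mulVec, vecMulVec_mulVec, vecMulVec_mulVec, E.dual, E.dual]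
    simp

theorem v_ne_zero (s : Bool) : E.v s ≠ 0 := by
  intro h
  have := E.dual s s
  simp [h] at this

theorem eq_smul_of_dotProduct_eq_zero {s : Bool} {w : Fin 2 → ℝ} (h : E.f s ⬝ᵥ w = 0) :
    w = (E.f (!s) ⬝ᵥ w) • E.v !s := by
  have h1 : w = (vecMulVec (E.v true) (E.f true) + vecMulVec (E.v false) (E.f false)) *ᵥ w := by
    rw [E.sum_eq_one, one_mulVec]
  rw [add_mulVec, vecMulVec_mulVec, vecMulVec_mulVec] at h1
  cases s
  · rw [h, MulOpposite.op_zero, zero_smul, add_zero, op_smul_eq_smul] at h1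
    exact h1
  · rw [h, MulOpposite.op_zero, zero_smul, zero_add, op_smul_eq_smul] at h1
    exact h1

end Eigensystem

theorem trace_eq_two_of_mulVec_eq {C : SpecialLinearGroup (Fin 2) ℝ} {v : Fin 2 → ℝ} (hv : v ≠ 0)
    (h : C.1 *ᵥ v = v) : C.1.trace = 2 := by
  have h1 : (C.1 - 1).det = 0 :=
    Matrix.exists_mulVec_eq_zero_iff.1 ⟨v, hv, by rw [sub_mulVec, h, one_mulVec, sub_self]⟩
  have h2 := C.2
  rw [Matrix.det_fin_two] at h1 h2
  rw [Matrix.trace_fin_two]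
  simp at h1
  linarith

theorem trace_commutator_eq_two {A B : SpecialLinearGroup (Fin 2) ℝ} {v : Fin 2 → ℝ} (hv : v ≠ 0)
    {μ ν : ℝ} (hμ : μ ≠ 0) (hν : ν ≠ 0) (hA : A.1 *ᵥ v = μ • v) (hB : B.1 *ᵥ v = ν • v) :
    (⁅A, B⁆).1.trace = 2 := by
  refine trace_eq_two_of_mulVec_eq hv ?_
  have inv (C : SpecialLinearGroup (Fin 2) ℝ) (c : ℝ) (hc : c ≠ 0) (h : C.1 *ᵥ v = c • v) :
      C⁻¹.1 *ᵥ v = c⁻¹ • v := by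
    have h1 : C⁻¹.1 *ᵥ (C.1 *ᵥ v) = v := by
      rw [mulVec_mulVec, show C⁻¹.1 * C.1 = (C⁻¹ * C).1 from rfl]
      simp
    rw [h, mulVec_smul] at h1
    nth_rw 2 [← h1]
    rw [smul_smul, inv_mul_cancel₀ hc, one_smul]
  rw [commutatorElement_def, show (A * B * A⁻¹ * B⁻¹).1 = A.1 * B.1 * A⁻¹.1 * B⁻¹.1 from rfl,
    ← mulVec_mulVec, ← mulVec_mulVec, ← mulVec_mulVec, inv B ν hν hB]
  simp only [mulVec_smul, inv A μ hμ hA, hA, hB, smul_smul]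
  field_simp
  rw [one_smul]

theorem dotProduct_mulVec_ne_zero {A A' B : SpecialLinearGroup (Fin 2) ℝ} (E : Eigensystem A.1)
    (E' : Eigensystem A'.1) (h : IsLoxodromic ⁅A, B * A' * B⁻¹⁆) (s t : Bool) :
    E.f s ⬝ᵥ (B.1 *ᵥ E'.v t) ≠ 0 := by
  intro h0
  obtain ⟨μ, hμ, hA⟩ := E.mulVec_v !s
  obtain ⟨ν, hν, hA'⟩ := E'.mulVec_v t
  have hBB : B⁻¹.1 *ᵥ (B.1 *ᵥ E'.v t) = E'.v t := by
    rw [mulVec_mulVec, show B⁻¹.1 * B.1 = (B⁻¹ * B).1 from rfl]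
    simp
  have hw : B.1 *ᵥ E'.v t ≠ 0 := by
    intro h1
    rw [h1, mulVec_zero] at hBB
    exact E'.v_ne_zero t hBB.symm
  have h1 := E.eq_smul_of_dotProduct_eq_zero h0
  have := trace_commutator_eq_two (A := A) (B := B * A' * B⁻¹) hw hμ hν
    (by rw [h1, mulVec_smul, hA, smul_comm])
    (by rw [show (B * A' * B⁻¹).1 = B.1 * A'.1 * B⁻¹.1 from rfl, ← mulVec_mulVec, ← mulVec_mulVec,
          hBB, hA', mulVec_smul])
  rw [IsLoxodromic, this] at h
  norm_num at h

theorem IsLoxodromic.nonempty_eigensystem {A : SpecialLinearGroup (Fin 2) ℝ}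
    (h : IsLoxodromic A) : Nonempty (Eigensystem A.1) := by
  obtain ⟨lam, h1, hl⟩ : ∃ lam : ℝ, 1 < |lam| ∧ lam + lam⁻¹ = A.1.trace := by
    rw [IsLoxodromic] at h
    set t := A.1.trace
    have hs : Real.sqrt (t ^ 2 - 4) ^ 2 = t ^ 2 - 4 := Real.sq_sqrt (by nlinarith [sq_abs t])
    have hs0 := Real.sqrt_nonneg (t ^ 2 - 4)
    set r := Real.sqrt (t ^ 2 - 4)
    rcases lt_or_ge 0 t with ht | ht
    · rw [abs_of_pos ht] at h
      refine ⟨(t + r) / 2, ?_, ?_⟩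
      · rw [abs_of_pos (by linarith)]
        linarith
      · have : (t + r) ≠ 0 := by positivity
        field_simp
        nlinarith
    · rw [abs_of_nonpos ht] at h
      refine ⟨(t - r) / 2, ?_, ?_⟩
      · rw [abs_of_neg (by linarith)]
        linarith
      · have : (t - r) ≠ 0 := by linarith
        field_simp
        nlinarith
  have h0 : lam ≠ 0 := by
    rintro rfl
    norm_num at h1
  have hd : lam - lam⁻¹ ≠ 0 := by
    intro hh
    have h2 : lam * lam = 1 := by
      field_simp at hh
      linarith
    have h3 : |lam| * |lam| = 1 := by rw [← abs_mul, h2, abs_one]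
    nlinarith
  have hdet := A.2
  rw [Matrix.det_fin_two] at hdet
  rw [Matrix.trace_fin_two] at hl
  set B := A.1
  have hll : lam * lam⁻¹ = 1 := mul_inv_cancel₀ h0
  set m := lam⁻¹
  obtain ⟨v, f, hvf⟩ := exists_eq_vecMulVec_of_det_eq_zero ((lam - m)⁻¹ • (B - m • 1)) (by
    rw [Matrix.det_smul, Matrix.det_fin_two]
    simp
    right
    linear_combination hdet + m * hl - hll)
  obtain ⟨w, p, hwp⟩ := exists_eq_vecMulVec_of_det_eq_zero ((lam - m)⁻¹ • (lam • 1 - B)) (by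
    rw [Matrix.det_smul, Matrix.det_fin_two]
    simp
    right
    linear_combination hdet + lam * hl - hll)
  have hsum : vecMulVec v f + vecMulVec w p = 1 := by
    rw [← hvf, ← hwp, ← smul_add, show B - m • 1 + (lam • 1 - B) = (lam - m) • (1 : Matrix _ _ ℝ) by
      rw [sub_smul]; abel, smul_smul, inv_mul_cancel₀ hd, one_smul]
  have heq : B = lam • vecMulVec v f + m • vecMulVec w p := by
    rw [← hvf, ← hwp, smul_comm lam, smul_comm m, ← smul_add,
      show lam • (B - m • 1) + m • (lam • 1 - B) = (lam - m) • B by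
        rw [smul_sub, smul_sub, smul_comm lam m, sub_smul]; abel,
      smul_smul, inv_mul_cancel₀ hd, one_smul]
  have hFV : (of ![f, p]) * (of ![v, w])ᵀ = 1 := by
    rw [mul_eq_one_comm, ← hsum]
    ext i j
    simp [Matrix.mul_apply, vecMulVec_apply]
  have dual (i j : Fin 2) : (![f, p] i) ⬝ᵥ (![v, w] j) = if i = j then 1 else 0 := by
    rw [← Matrix.one_apply, ← hFV]
    rfl
  exact ⟨{  lam := lam
            v := fun s => if s then v else w
            f := fun s => if s then f else p
            one_lt := h1
            dual := by
              intro s t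
              cases s <;> cases t
              · simpa using dual 1 1
              · simpa using dual 1 0
              · simpa using dual 0 1
              · simpa using dual 0 0
            sum_eq_one := hsum
            eq_sum := heq }⟩

theorem prod_mulVec_of_isChain {X : Type*} (v f : X → Fin 2 → ℝ) (a b : X) (l : List X)
    (h : List.IsChain (fun x y => f x ⬝ᵥ v y ≠ 0) (a :: (l ++ [b]))) :
    ∃ c : ℝ, c ≠ 0 ∧ ((a :: l).map fun x => vecMulVec (v x) (f x)).prod *ᵥ v b = c • v a := by
  induction l generalizing a with
  | nil =>
    refine ⟨f a ⬝ᵥ v b, by simpa using h, ?_⟩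
    rw [List.map_singleton, List.prod_singleton, vecMulVec_mulVec, op_smul_eq_smul]
  | cons x l ih =>
    rw [List.cons_append, List.isChain_cons_cons] at h
    obtain ⟨c, hc, h1⟩ := ih x h.2
    refine ⟨c * (f a ⬝ᵥ v x), mul_ne_zero hc h.1, ?_⟩
    rw [List.map_cons, List.prod_cons, ← mulVec_mulVec, h1, mulVec_smul, vecMulVec_mulVec,
      op_smul_eq_smul, smul_smul]

theorem trace_prod_ne_zero_of_isChain {X : Type*} (v f : X → Fin 2 → ℝ) (a : X) (l : List X)
    (h : List.IsChain (fun x y => f x ⬝ᵥ v y ≠ 0) (a :: (l ++ [a]))) :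
    ((a :: l).map fun x => vecMulVec (v x) (f x)).prod.trace ≠ 0 := by
  have hva : v a ≠ 0 := by
    intro h0
    obtain ⟨y, hy⟩ : ∃ y, f y ⬝ᵥ v a ≠ 0 := by
      have := (List.isChain_append.1 (show List.IsChain _ ((a :: l) ++ [a]) from h)).2.2
      exact ⟨_, this _ (List.getLast?_eq_some_getLast (List.cons_ne_nil _ _)) a (by simp)⟩
    rw [h0, dotProduct_zero] at hy
    exact hy rfl
  obtain ⟨c, hc, h1⟩ := prod_mulVec_of_isChain v f a a l h
  rw [List.map_cons, List.prod_cons] at h1 ⊢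
  rw [vecMulVec_mul, vecMulVec_mulVec, op_smul_eq_smul] at h1
  rw [vecMulVec_mul, trace_vecMulVec, dotProduct_comm]
  rwa [smul_left_injective ℝ hva h1]

/-- A product of large powers of loxodromic elements, with fixed coefficients in between, is
loxodromic as soon as consecutive axes (in the cyclic order) are in general position. -/
theorem eventually_isLoxodromic_prod {L : Type*} {A : L → SpecialLinearGroup (Fin 2) ℝ}
    (E : ∀ l, Eigensystem (A l).1) (a : SpecialLinearGroup (Fin 2) ℝ × L × Bool)
    (w : List (SpecialLinearGroup (Fin 2) ℝ × L × Bool))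
    (h : List.IsChain (fun x y => (E x.2.1).f x.2.2 ⬝ᵥ (y.1.1 *ᵥ (E y.2.1).v y.2.2) ≠ 0)
      (a :: (w ++ [a]))) :
    ∀ᶠ k : ℕ in atTop,
      IsLoxodromic (((a :: w).map fun x => x.1 * signed x.2.2 (A x.2.1) ^ k).prod) := by
  set M : SpecialLinearGroup (Fin 2) ℝ × L × Bool → ℕ → SpecialLinearGroup (Fin 2) ℝ :=
    fun x k => x.1 * signed x.2.2 (A x.2.1) ^ k with hM
  have lim (l : List (SpecialLinearGroup (Fin 2) ℝ × L × Bool)) :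
      Tendsto (fun k : ℕ => (l.map fun x => (E x.2.1).lam⁻¹ ^ k).prod • ((l.map fun x => M x k).prod).1)
        atTop (𝓝 (l.map fun x =>
          vecMulVec (x.1.1 *ᵥ (E x.2.1).v x.2.2) ((E x.2.1).f x.2.2)).prod) := by
    induction l with
    | nil =>
      simp only [List.map_nil, List.prod_nil, one_smul]
      exact tendsto_const_nhds
    | cons x l ih =>
      simp only [List.map_cons, List.prod_cons]
      have h1 : Tendsto (fun k : ℕ => (E x.2.1).lam⁻¹ ^ k • (M x k).1) atTop
          (𝓝 (vecMulVec (x.1.1 *ᵥ (E x.2.1).v x.2.2) ((E x.2.1).f x.2.2))) := by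
        rw [← mul_vecMulVec]
        refine (((E x.2.1).tendsto_signed_pow x.2.2).const_mul x.1.1).congr fun k => ?_
        rw [mul_smul_comm]
        rfl
      refine (h1.mul ih).congr fun k => ?_
      rw [smul_mul_smul_comm]
      rfl
  have lim0 (b : SpecialLinearGroup (Fin 2) ℝ × L × Bool)
      (l : List (SpecialLinearGroup (Fin 2) ℝ × L × Bool)) :
      Tendsto (fun k : ℕ => ((b :: l).map fun x => (E x.2.1).lam⁻¹ ^ k).prod) atTop (𝓝 0) := by
    induction l generalizing b with
    | nil => simpa using (E b.2.1).tendsto_lam_inv_pow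
    | cons x l ih =>
      have := (E b.2.1).tendsto_lam_inv_pow.mul (ih x)
      rw [mul_zero] at this
      exact this
  have htr := trace_prod_ne_zero_of_isChain
    (fun x : SpecialLinearGroup (Fin 2) ℝ × L × Bool => x.1.1 *ᵥ (E x.2.1).v x.2.2)
    (fun x => (E x.2.1).f x.2.2) a w h
  have h1 := ((continuous_id.matrix_trace.tendsto _).comp (lim (a :: w))).abs
  have h2 := (lim0 a w).abs
  have h3 := abs_pos.2 htr
  rw [abs_zero] at h2
  filter_upwards [h1.eventually_const_lt (half_lt_self h3), h2.eventually_lt_const (show 0 < |(((a :: w).map fun x =>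
    vecMulVec (x.1.1 *ᵥ (E x.2.1).v x.2.2) ((E x.2.1).f x.2.2)).prod).trace| / 4 by positivity)] with k h4 h5
  simp only [Function.comp, id, trace_smul, smul_eq_mul, abs_mul] at h4
  set t := |(((a :: w).map fun x =>
    vecMulVec (x.1.1 *ᵥ (E x.2.1).v x.2.2) ((E x.2.1).f x.2.2)).prod).trace|
  rw [IsLoxodromic]
  by_contra h6
  push Not at h6
  nlinarith [abs_nonneg ((((a :: w).map fun x => M x k).prod).1.trace), abs_nonneg ((((a :: w).map fun x => (E x.2.1).lam⁻¹ ^ k).prod))]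

/-- Cyclic reduction: a cyclic word either reduces to a degenerate one, or is equivalent to
a word with no bad consecutive pair of letters, in the cyclic order. -/
theorem exists_isChain_cyclic {X : Type*} {R : List X → Prop} {Bad : X → X → Prop} {V : Prop}
    (nil : R [] → V) (rot : ∀ x l, R (x :: l) → R (l ++ [x]))
    (red : ∀ x y l, R (x :: y :: l) → Bad x y → V ∨ ∃ l', l'.length < l.length + 2 ∧ R l')
    (self : ∀ x, R [x] → Bad x x → V) (l : List X) (h : R l) :
    V ∨ ∃ a l', R (a :: l') ∧ List.IsChain (fun x y => ¬ Bad x y) (a :: (l' ++ [a])) := by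
  induction hn : l.length using Nat.strong_induction_on generalizing l with
  | _ n ih =>
  subst hn
  have rotate (u v : List X) (huv : R (u ++ v)) : R (v ++ u) := by
    induction u generalizing v with
    | nil => simpa using huv
    | cons x u ihu =>
      have := ihu (v ++ [x]) (by simpa using rot x (u ++ v) huv)
      simpa using this
  have front (x y : X) (l' : List X) (hl : l'.length + 2 = l.length) (hR : R (x :: y :: l'))
      (hb : Bad x y) :
      V ∨ ∃ a l', R (a :: l') ∧ List.IsChain (fun x y => ¬ Bad x y) (a :: (l' ++ [a])) := by
    rcases red x y l' hR hb with hV | ⟨l'', h1, h2⟩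
    · exact Or.inl hV
    · exact ih _ (by omega) l'' h2 rfl
  rcases l with _ | ⟨a, l⟩
  · exact Or.inl (nil h)
  by_cases hc : List.IsChain (fun x y => ¬ Bad x y) (a :: (l ++ [a]))
  · exact Or.inr ⟨a, l, h, hc⟩
  rw [← List.cons_append] at hc
  by_cases hc' : List.IsChain (fun x y => ¬ Bad x y) (a :: l)
  · rcases List.eq_nil_or_concat l with rfl | ⟨l', b, rfl⟩
    · left
      refine self a h ?_
      by_contra hb
      exact hc (by simpa using hb)
    · refine front b a l' (by simp) ?_ ?_
      · have := rotate (a :: l') [b] (by simpa using h)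
        simpa using this
      · by_contra hb
        refine hc (List.isChain_append.2 ⟨hc', by simp, fun x hx y hy => ?_⟩)
        rw [List.concat_eq_append, ← List.cons_append, List.getLast?_concat] at hx
        simp only [Option.mem_def, Option.some.injEq, List.head?_cons] at hx hy
        subst hx hy
        exact hb
  · rw [List.isChain_iff_forall_rel_of_append_cons_cons] at hc'
    push Not at hc'
    obtain ⟨x, y, u, v, huv, hb⟩ := hc'
    refine front x y (v ++ u) ?_ ?_ hb
    · rw [huv]
      simp
      omega
    · have := rotate u (x :: y :: v) (huv ▸ h)
      simpa using this

theorem signed_mul_signed_not {G : Type*} [Group G] (s : Bool) (x : G) :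
    signed s x * signed (!s) x = 1 := by
  cases s <;> simp [signed]

theorem signed_pow {G : Type*} [Group G] (s : Bool) (x : G) (k : ℕ) :
    signed s (x ^ k) = signed s x ^ k := by
  cases s <;> simp [signed]

/-- Matrices with eigenvalues `2` and `1/2` such that distinct ones have disjoint axes. -/
noncomputable def schottkyGen (i : ℕ) : SpecialLinearGroup (Fin 2) ℝ :=
  ⟨!![3 * i + 2, -3 / 2; 3 * i * (2 * i + 1), 1 / 2 - 3 * i], by
    rw [Matrix.det_fin_two_of]
    ring⟩

/-- The diagonalization of `schottkyGen`. -/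
noncomputable def schottkyEigensystem (i : ℕ) : Eigensystem (schottkyGen i).1 where
  lam := 2
  v s := if s then ![1, 2 * i] else ![1, 2 * i + 1]
  f s := if s then ![2 * i + 1, -1] else ![-2 * i, 1]
  one_lt := by norm_num
  dual s t := by cases s <;> cases t <;> simp
  sum_eq_one := by
    ext a b
    fin_cases a <;> fin_cases b <;> simp
    ring
  eq_sum := by
    ext a b
    fin_cases a <;> fin_cases b <;> simp [schottkyGen] <;> ring


theorem schottky_dotProduct_ne_zero {i j : ℕ} {s t : Bool} (h : ¬ (i = j ∧ s = !t)) :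
    (schottkyEigensystem i).f s ⬝ᵥ (schottkyEigensystem j).v t ≠ 0 := by
  intro h0
  apply h
  have : (2 * (i : ℝ) + if s then 1 else 0) = 2 * (j : ℝ) + if t then 0 else 1 := by
    cases s <;> cases t <;> simp [schottkyEigensystem] at h0 ⊢ <;>
      first
      | linarith
      | exact_mod_cast (by linarith : (i : ℝ) = j)
  have h1 : 2 * i + (if s then 1 else 0) = 2 * j + if t then 0 else 1 := by exact_mod_cast this
  cases s <;> cases t <;> simp at h1 ⊢ <;> omega

theorem eventually_isLoxodromic_lift_schottkyGen {m : ℕ} {g : FreeGroup (Fin m)} (hg : g ≠ 1) :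
    ∀ᶠ k : ℕ in atTop, IsLoxodromic (FreeGroup.lift (fun i : Fin m => schottkyGen i ^ k) g) := by
  have key := exists_isChain_cyclic (R := fun l => IsConj g (FreeGroup.mk l))
    (Bad := fun x y : Fin m × Bool => x.1 = y.1 ∧ x.2 = !y.2) (V := g = 1)
    (fun h => isConj_one_left.1 h)
    (fun x l h => h.trans (isConj_iff.2 ⟨(FreeGroup.mk [x])⁻¹, by
      rw [show x :: l = [x] ++ l from rfl, ← FreeGroup.mul_mk, ← FreeGroup.mul_mk]
      group⟩))
    (fun x y l h hb => Or.inr ⟨l, by omega, by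
      obtain ⟨i, s⟩ := x
      obtain ⟨j, t⟩ := y
      obtain ⟨h1, h2⟩ := hb
      dsimp only at h1 h2
      subst h1 h2
      rwa [show FreeGroup.mk ((i, !t) :: (i, t) :: l) = FreeGroup.mk l from
        Quot.sound FreeGroup.Red.Step.cons_not_rev] at h⟩)
    (fun x _ hb => by simp at hb)
    g.toWord (by rw [FreeGroup.mk_toWord])
  rcases key with h | ⟨a, l, hR, hc⟩
  · exact absurd h hg
  have := eventually_isLoxodromic_prod (fun i : Fin m => schottkyEigensystem i) (1, a)
    (l.map fun x => (1, x)) (by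
      rw [show ((1, a) :: (l.map (fun x => (1, x)) ++ [(1, a)]) :
          List (SpecialLinearGroup (Fin 2) ℝ × Fin m × Bool)) =
          (a :: (l ++ [a])).map (fun x => (1, x)) by simp, List.isChain_map]
      refine hc.imp fun x y hxy => ?_
      change _ ⬝ᵥ ((1 : Matrix (Fin 2) (Fin 2) ℝ) *ᵥ _) ≠ 0
      rw [one_mulVec]
      exact schottky_dotProduct_ne_zero fun h => hxy ⟨Fin.ext h.1, h.2⟩)
  filter_upwards [this] with k hk
  refine IsLoxodromic.of_isConj ((FreeGroup.lift _).map_isConj hR) ?_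
  rw [FreeGroup.lift_mk]
  rw [← List.map_cons (f := fun x => ((1 : SpecialLinearGroup (Fin 2) ℝ), x)), List.map_map] at hk
  refine (congrArg (fun w : List _ => IsLoxodromic w.prod) ?_).mp hk
  refine List.map_congr_left fun x _ => ?_
  simp only [Function.comp, one_mul]
  cases x.2 <;> simp [signed]

theorem exists_forall_isLoxodromic {m : ℕ} {S : Set (FreeGroup (Fin m))} (hS : S.Finite)
    (h1 : 1 ∉ S) :
    ∃ θ : FreeGroup (Fin m) →* SpecialLinearGroup (Fin 2) ℝ, ∀ g ∈ S, IsLoxodromic (θ g) := by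
  have := (eventually_all_finite hS).2 fun g hg =>
    eventually_isLoxodromic_lift_schottkyGen (g := g) (fun h => h1 (h ▸ hg))
  obtain ⟨k, hk⟩ := this.exists
  exact ⟨_, hk⟩

theorem FreeGroup.exists_mem_zpowers_of_commute {ι : Type*} {x y : FreeGroup ι}
    (h : Commute x y) : ∃ r, x ∈ Subgroup.zpowers r ∧ y ∈ Subgroup.zpowers r := by
  classical
  set H := Subgroup.closure {x, y} with hH
  have hcomm : ∀ a b : H, a * b = b * a := by
    have := Subgroup.isMulCommutative_closure (k := {x, y}) (by
      rintro a (rfl | rfl) b (rfl | rfl)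
      exacts [rfl, h, h.symm, rfl])
    exact fun a b => this.is_comm.comm a b
  let f := IsFreeGroup.toFreeGroup H
  have hsub : Subsingleton (IsFreeGroup.Generators H) := by
    refine ⟨fun a b => ?_⟩
    by_contra hab
    have h1 := congrArg f (hcomm (f.symm (FreeGroup.of a)) (f.symm (FreeGroup.of b)))
    rw [_root_.map_mul, _root_.map_mul, MulEquiv.apply_symm_apply, MulEquiv.apply_symm_apply] at h1
    have h2 := congrArg (FreeGroup.lift fun z => if z = a then Equiv.swap (0 : Fin 3) 1 else
      Equiv.swap (1 : Fin 3) 2) h1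
    rw [_root_.map_mul, _root_.map_mul, FreeGroup.lift_apply_of, FreeGroup.lift_apply_of, if_pos rfl,
      if_neg (Ne.symm hab)] at h2
    revert h2
    decide
  have hc : IsCyclic H := by
    cases isEmpty_or_nonempty (IsFreeGroup.Generators H)
    · have : Subsingleton H := f.toEquiv.subsingleton
      infer_instance
    · have : Unique (IsFreeGroup.Generators H) := uniqueOfSubsingleton (Classical.arbitrary _)
      exact (f.isCyclic).2 inferInstance
  obtain ⟨r, hr⟩ := hc
  refine ⟨r, ?_, ?_⟩
  · obtain ⟨k, hk⟩ := hr ⟨x, Subgroup.subset_closure (by simp)⟩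
    exact ⟨k, by simpa using congrArg Subtype.val hk⟩
  · obtain ⟨k, hk⟩ := hr ⟨y, Subgroup.subset_closure (by simp)⟩
    exact ⟨k, by simpa using congrArg Subtype.val hk⟩

theorem FreeGroup.mem_zpowers_of_commute_conj {ι : Type*} {u h : FreeGroup ι}
    (χ : FreeGroup ι →* Multiplicative ℤ) (hu : (χ u).toAdd = 1)
    (hc : Commute u (h * u * h⁻¹)) : h ∈ Subgroup.zpowers u := by
  obtain ⟨r, ⟨a, ha⟩, ⟨b, hb⟩⟩ := FreeGroup.exists_mem_zpowers_of_commute hc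
  dsimp only at ha hb
  have h1 : a * (χ r).toAdd = 1 := by rw [← hu, ← ha]; simp
  have h2 : b * (χ r).toAdd = 1 := by
    rw [← hu, show χ u = χ (h * u * h⁻¹) by simp [mul_comm], ← hb]
    simp
  have hab : a = b := by
    have h0 : (χ r).toAdd ≠ 0 := by
      intro h0
      simp [h0] at h1
    exact mul_right_cancel₀ h0 (h1.trans h2.symm)
  have hc' : Commute u h := by
    rw [← hab, ha] at hb
    exact (eq_mul_inv_iff_mul_eq.1 hb)
  obtain ⟨s, ⟨a, rfl⟩, ⟨b, rfl⟩⟩ := FreeGroup.exists_mem_zpowers_of_commute hc'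
  dsimp only at hu ⊢
  have h3 : a * (χ s).toAdd = 1 := by rw [← hu]; simp
  have h4 : s = (s ^ a) ^ a := by
    rcases Int.eq_one_or_neg_one_of_mul_eq_one h3 with rfl | rfl <;> simp
  exact Subgroup.zpow_mem _ (Subgroup.mem_zpowers_iff.2 ⟨a, h4.symm⟩) b

theorem FreeGroup.not_commute_conj {ι : Type*} {u u' h : FreeGroup ι}
    (χ : FreeGroup ι →* Multiplicative ℤ) (hu : χ u ≠ 1) (hu' : χ u' = 1) (h1 : u' ≠ 1) :
    ¬ Commute u (h * u' * h⁻¹) := by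
  intro hc
  obtain ⟨r, ⟨a, ha⟩, ⟨b, hb⟩⟩ := FreeGroup.exists_mem_zpowers_of_commute hc
  dsimp only at ha hb
  have h2 : χ r ≠ 1 := by
    intro h2
    rw [← ha, map_zpow, h2, _root_.one_zpow] at hu
    exact hu rfl
  have h3 : χ r ^ b = 1 := by
    rw [← map_zpow, hb]
    simp [hu']
  have h4 : b = 0 := by
    have := congrArg Multiplicative.toAdd h3
    simp at this
    exact this.resolve_right h2
  rw [h4, zpow_zero] at hb
  exact h1 (by simpa using hb.symm)

/-- The homomorphism counting generators with the given weights. -/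
def FreeGroup.weight {ι : Type*} (w : ι → ℤ) : FreeGroup ι →* Multiplicative ℤ :=
  FreeGroup.lift fun i => Multiplicative.ofAdd (w i)

@[simp]
theorem FreeGroup.weight_of {ι : Type*} (w : ι → ℤ) (i : ι) :
    FreeGroup.weight w (FreeGroup.of i) = Multiplicative.ofAdd (w i) :=
  FreeGroup.lift_apply_of

theorem FreeGroup.exists_forall_commutator_ne_one {m : ℕ} (hm : 2 ≤ m)
    {H : Set (FreeGroup (Fin m))} (hH : H.Finite) (h1 : 1 ∉ H) :
    ∃ U : FreeGroup (Fin m), U ≠ 1 ∧ ∀ h ∈ H, ⁅U, h * U * h⁻¹⁆ ≠ 1 := by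
  let i : Fin m := ⟨0, by omega⟩
  let j : Fin m := ⟨1, by omega⟩
  have hij : i ≠ j := by simp [i, j]
  let χ := FreeGroup.weight (Pi.single i 1 : Fin m → ℤ)
  let ψ := FreeGroup.weight (Pi.single j 1 : Fin m → ℤ)
  obtain ⟨N, hN⟩ := (hH.image fun h => (ψ h).toAdd.natAbs).bddAbove
  let U : FreeGroup (Fin m) := FreeGroup.of i * FreeGroup.of j ^ (N + 1)
  have hU : (χ U).toAdd = 1 := by simp [χ, U, hij]
  have hU' : (ψ U).toAdd = N + 1 := by simp [ψ, U, hij.symm]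
  refine ⟨U, fun h => by simp [h] at hU, fun h hh hc => ?_⟩
  obtain ⟨k, rfl⟩ := FreeGroup.mem_zpowers_of_commute_conj χ hU
    (commutatorElement_eq_one_iff_commute.1 hc)
  have h2 : (k * (N + 1)).natAbs ≤ N := by
    have := hN ⟨_, hh, rfl⟩
    simpa [hU'] using this
  have h3 : k = 0 := by
    rw [Int.natAbs_mul] at h2
    by_contra h0
    have : 1 ≤ k.natAbs := by omega
    have : ((N : ℤ) + 1).natAbs = N + 1 := by omega
    nlinarith
  subst h3
  exact h1 (by simpa using hh)

namespace FreeGroup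

/-- The retraction onto the free group on the first `m` generators sending the last
generator to `V`. -/
def lastTo {m : ℕ} (V : FreeGroup (Fin m)) : FreeGroup (Fin (m + 1)) →* FreeGroup (Fin m) :=
  lift (Fin.lastCases V of)

@[simp]
theorem lastTo_of_last {m : ℕ} (V : FreeGroup (Fin m)) : lastTo V (of (Fin.last m)) = V := by
  simp [lastTo]

@[simp]
theorem lastTo_of_castSucc {m : ℕ} (V : FreeGroup (Fin m)) (i : Fin m) :
    lastTo V (of i.castSucc) = of i := by
  simp [lastTo]

@[simp]
theorem lastTo_map_castSucc {m : ℕ} (V h : FreeGroup (Fin m)) :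
    lastTo V (map Fin.castSucc h) = h := by
  have : (lastTo V).comp (map Fin.castSucc) = MonoidHom.id _ := by
    ext i
    simp
  exact DFunLike.congr_fun this h

/-- The product of `hⱼ t^{εⱼ}`, where `t` is the last generator. -/
def lastWord {m : ℕ} (l : List (FreeGroup (Fin m) × Bool)) : FreeGroup (Fin (m + 1)) :=
  (l.map fun x => map Fin.castSucc x.1 * signed x.2 (of (Fin.last m))).prod

theorem lastWord_cons {m : ℕ} (x : FreeGroup (Fin m) × Bool) (l : List (FreeGroup (Fin m) × Bool)) :
    lastWord (x :: l) =
      map Fin.castSucc x.1 * signed x.2 (of (Fin.last m)) * lastWord l := by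
  simp [lastWord]

theorem exists_eq_lastWord_mul {m : ℕ} (g : FreeGroup (Fin (m + 1))) :
    ∃ l h, g = lastWord l * map Fin.castSucc h := by
  have hg : g ∈ Subgroup.closure (Set.range (of : Fin (m + 1) → _)) := by
    rw [closure_range_of]
    trivial
  have absorb (h : FreeGroup (Fin m)) (l : List (FreeGroup (Fin m) × Bool)) (h' : FreeGroup (Fin m)) :
      ∃ l' h'', map Fin.castSucc h * (lastWord l * map Fin.castSucc h') =
        lastWord l' * map Fin.castSucc h'' := by
    rcases l with _ | ⟨x, l⟩
    · exact ⟨[], h * h', by simp [lastWord]⟩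
    · exact ⟨(h * x.1, x.2) :: l, h', by simp [lastWord_cons, mul_assoc]⟩
  have letter (s : Bool) (l : List (FreeGroup (Fin m) × Bool)) (h' : FreeGroup (Fin m)) :
      ∃ l' h'', signed s (of (Fin.last m)) * (lastWord l * map Fin.castSucc h') =
        lastWord l' * map Fin.castSucc h'' :=
    ⟨(1, s) :: l, h', by simp [lastWord_cons, mul_assoc]⟩
  induction hg using Subgroup.closure_induction_left with
  | one => exact ⟨[], 1, by simp [lastWord]⟩
  | mul_left x hx y _ ih =>
    obtain ⟨i, rfl⟩ := hx
    obtain ⟨l, h, rfl⟩ := ih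
    cases i using Fin.lastCases with
    | last => exact letter true l h
    | cast i => simpa using absorb (of i) l h
  | inv_mul_cancel x hx y _ ih =>
    obtain ⟨i, rfl⟩ := hx
    obtain ⟨l, h, rfl⟩ := ih
    cases i using Fin.lastCases with
    | last => exact letter false l h
    | cast i => simpa using absorb (of i)⁻¹ l h

theorem isConj_map_or_exists_lastWord {m : ℕ} (g : FreeGroup (Fin (m + 1))) :
    (∃ h, IsConj g (map Fin.castSucc h)) ∨ ∃ a l, IsConj g (lastWord (a :: l)) ∧
      List.IsChain (fun x y => ¬ (y.1 = 1 ∧ x.2 = !y.2)) (a :: (l ++ [a])) := by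
  obtain ⟨l, h, hg⟩ := exists_eq_lastWord_mul g
  have hconj : IsConj g (map Fin.castSucc h * lastWord l) :=
    isConj_iff.2 ⟨map Fin.castSucc h, by rw [hg]; group⟩
  rcases l with _ | ⟨x, l⟩
  · exact Or.inl ⟨h, by simpa [lastWord] using hconj⟩
  refine exists_isChain_cyclic (R := fun l => IsConj g (lastWord l))
    (Bad := fun x y => y.1 = 1 ∧ x.2 = !y.2) (fun h => ⟨1, by simpa [lastWord] using h⟩)
    (fun x l h => h.trans (isConj_iff.2 ⟨(lastWord [x])⁻¹, by simp [lastWord, mul_assoc]⟩))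
    ?_ (fun x _ hb => by simp at hb) ((h * x.1, x.2) :: l)
    (by simpa [lastWord_cons, mul_assoc] using hconj)
  rintro ⟨h₁, s⟩ ⟨h₂, t⟩ l hR ⟨h2, hs⟩
  dsimp only at h2 hs
  subst h2 hs
  have h3 : lastWord ((h₁, !t) :: (1, t) :: l) = map Fin.castSucc h₁ * lastWord l := by
    have := signed_mul_signed_not (!t) (of (Fin.last m))
    rw [Bool.not_not] at this
    rw [lastWord_cons, lastWord_cons]
    dsimp only
    rw [_root_.map_one, one_mul, ← mul_assoc, mul_assoc (map Fin.castSucc h₁), this, mul_one]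
  rw [h3] at hR
  rcases l with _ | ⟨y, l⟩
  · exact Or.inl ⟨h₁, by simpa [lastWord] using hR⟩
  · exact Or.inr ⟨(h₁ * y.1, y.2) :: l, by simp, by simpa [lastWord_cons, mul_assoc] using hR⟩

theorem exists_eventually_isLoxodromic_lastTo {m : ℕ} {g : FreeGroup (Fin (m + 1))} (hg : g ≠ 1) :
    ∃ H : Set (FreeGroup (Fin m)), H.Finite ∧ 1 ∉ H ∧
      ∀ U : FreeGroup (Fin m), U ≠ 1 → (∀ h ∈ H, ⁅U, h * U * h⁻¹⁆ ≠ 1) →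
        ∃ T : Set (FreeGroup (Fin m)), T.Finite ∧ 1 ∉ T ∧
          ∀ θ : FreeGroup (Fin m) →* SpecialLinearGroup (Fin 2) ℝ, (∀ h ∈ T, IsLoxodromic (θ h)) →
            ∀ᶠ k : ℕ in atTop, IsLoxodromic (θ (lastTo (U ^ k) g)) := by
  rcases isConj_map_or_exists_lastWord g with ⟨h, hgh⟩ | ⟨a, l, hR, hc⟩
  · refine ⟨∅, by simp, by simp, fun U _ _ => ⟨{h}, by simp, ?_, fun θ hθ => ?_⟩⟩
    · rintro rfl
      rw [_root_.map_one] at hgh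
      exact hg (isConj_one_left.1 hgh)
    · refine Eventually.of_forall fun k => IsLoxodromic.of_isConj
        ((θ.comp (lastTo (U ^ k))).map_isConj hgh) ?_
      simpa using hθ
  refine ⟨{h | h ≠ 1 ∧ h ∈ (a :: l).map Prod.fst},
    ((a :: l).map Prod.fst).finite_toSet.subset fun _ h => h.2, fun h => h.1 rfl,
    fun U hU hH => ?_⟩
  refine ⟨insert U ((fun h => ⁅U, h * U * h⁻¹⁆) '' {h | h ≠ 1 ∧ h ∈ (a :: l).map Prod.fst}), ?_, ?_,
    fun θ hθ => ?_⟩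
  · exact ((((a :: l).map Prod.fst).finite_toSet.subset fun _ h => h.2).image _).insert _
  · rintro (h | ⟨h, hh, h1⟩)
    · exact hU h.symm
    · exact hH h hh h1
  obtain ⟨E⟩ := (hθ U (by simp)).nonempty_eigensystem
  have := eventually_isLoxodromic_prod (fun _ : Unit => E) (θ a.1, (), a.2)
    (l.map fun x => (θ x.1, (), x.2)) (by
      rw [show ((θ a.1, (), a.2) :: (l.map (fun x => (θ x.1, (), x.2)) ++ [(θ a.1, (), a.2)]) :
          List (SpecialLinearGroup (Fin 2) ℝ × Unit × Bool)) =
          (a :: (l ++ [a])).map (fun x => (θ x.1, (), x.2)) by simp, List.isChain_map]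
      refine hc.imp_of_mem_imp fun x y hx hy hxy => ?_
      dsimp only
      by_cases h1 : y.1 = 1
      · rw [h1, _root_.map_one]
        change _ ⬝ᵥ ((1 : Matrix (Fin 2) (Fin 2) ℝ) *ᵥ _) ≠ 0
        have h2 : x.2 = y.2 := by
          by_contra h2
          exact hxy ⟨h1, by cases h3 : x.2 <;> cases h4 : y.2 <;> simp_all⟩
        rw [one_mulVec, E.dual, h2]
        simp
      · refine dotProduct_mulVec_ne_zero E E ?_ _ _
        have h2 := hθ ⁅U, y.1 * U * y.1⁻¹⁆ (Or.inr ⟨y.1, ⟨h1, by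
          have : y ∈ a :: l := by simpa [or_comm, or_assoc] using hy
          exact List.mem_map_of_mem this⟩, rfl⟩)
        simpa [map_commutatorElement] using h2)
  filter_upwards [this] with k hk
  refine IsLoxodromic.of_isConj ((θ.comp (lastTo (U ^ k))).map_isConj hR) ?_
  rw [lastWord, map_list_prod, List.map_map]
  rw [← List.map_cons (f := fun x : FreeGroup (Fin m) × Bool => (θ x.1, (), x.2)),
    List.map_map] at hk
  refine (congrArg (fun w : List _ => IsLoxodromic w.prod) ?_).mp hk
  refine List.map_congr_left fun x _ => ?_
  simp only [Function.comp, MonoidHom.comp_apply, _root_.map_mul, lastTo_map_castSucc, map_signed,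
    lastTo_of_last, _root_.map_pow, signed_pow]

theorem exists_forall_isLoxodromic_lastTo {m : ℕ} (hm : 2 ≤ m) {S : Set (FreeGroup (Fin (m + 1)))}
    (hS : S.Finite) (h1 : 1 ∉ S) :
    ∃ (V : FreeGroup (Fin m)) (θ : FreeGroup (Fin m) →* SpecialLinearGroup (Fin 2) ℝ),
      ∀ g ∈ S, IsLoxodromic (θ (lastTo V g)) := by
  have hne : ∀ g : S, g.1 ≠ 1 := fun g h => h1 (h ▸ g.2)
  choose H hH hH1 hHU using fun g : S => exists_eventually_isLoxodromic_lastTo (hne g)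
  have : Finite S := hS
  obtain ⟨U, hU, hUH⟩ := exists_forall_commutator_ne_one hm (Set.finite_iUnion hH)
    (by simpa using hH1)
  choose T hT hT1 hTθ using fun g : S => hHU g U hU fun h hh => hUH h (Set.mem_iUnion.2 ⟨g, hh⟩)
  obtain ⟨θ, hθ⟩ := exists_forall_isLoxodromic (Set.finite_iUnion hT) (by simpa using hT1)
  obtain ⟨k, hk⟩ := (eventually_all.2 fun g =>
    hTθ g θ fun h hh => hθ h (Set.mem_iUnion.2 ⟨g, hh⟩)).exists
  exact ⟨U ^ k, θ, fun g hg => hk ⟨g, hg⟩⟩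

end FreeGroup

/-- The product of the first `n` values of `r`. -/
def partialProd {G : Type*} [Group G] {g : ℕ} (r : Fin g → G) (n : ℕ) : G :=
  ((List.ofFn r).take n).prod

section partialProd

variable {G H : Type*} [Group G] [Group H] {g : ℕ}

@[simp]
theorem partialProd_zero (r : Fin g → G) : partialProd r 0 = 1 := by
  simp [partialProd]

theorem partialProd_succ (r : Fin g → G) (i : Fin g) :
    partialProd r (i + 1) = partialProd r i * r i := by
  rw [partialProd, List.prod_take_succ _ _ (by simp)]
  simp [partialProd]

theorem partialProd_self (r : Fin g → G) : partialProd r g = (List.ofFn r).prod := by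
  rw [partialProd, List.take_of_length_le (by simp)]

theorem map_partialProd (φ : G →* H) (r : Fin g → G) (n : ℕ) :
    φ (partialProd r n) = partialProd (fun i => φ (r i)) n := by
  rw [partialProd, map_list_prod, List.map_take, List.map_ofFn]
  rfl

theorem partialProd_telescope {r r' : Fin g → G} (q : ℕ → G)
    (h : ∀ i : Fin g, r' i = q i * r i * (q (i + 1))⁻¹) {n : ℕ} (hn : n ≤ g) :
    partialProd r' n = q 0 * partialProd r n * (q n)⁻¹ := by
  induction n with
  | zero => simp
  | succ n ih =>
    rw [partialProd_succ r' ⟨n, hn⟩, partialProd_succ r ⟨n, hn⟩, h, ih (by omega)]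
    simp [mul_assoc]

end partialProd

namespace SurfaceGroup

variable {g : ℕ} {G : Type*} [Group G]

/-- The homomorphism from the surface group determined by the images of the generators. -/
def lift (A B : Fin g → G) (h : partialProd (fun i => ⁅A i, B i⁆) g = 1) : SurfaceGroup g →* G :=
  PresentedGroup.toGroup (rels := surfaceRel g) (f := Sum.elim A B) (by
    rintro _ rfl
    rw [partialProd_self] at h
    rw [map_list_prod, List.map_ofFn, ← h]
    congr 2
    ext i
    simp [commutatorElement_def])

@[simp]
theorem lift_genA (A B : Fin g → G) (h : partialProd (fun i => ⁅A i, B i⁆) g = 1) (i : Fin g) :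
    lift A B h (genA g i) = A i :=
  PresentedGroup.toGroup.of _

@[simp]
theorem lift_genB (A B : Fin g → G) (h : partialProd (fun i => ⁅A i, B i⁆) g = 1) (i : Fin g) :
    lift A B h (genB g i) = B i :=
  PresentedGroup.toGroup.of _

theorem hom_ext {φ ψ : SurfaceGroup g →* G} (hA : ∀ i, φ (genA g i) = ψ (genA g i))
    (hB : ∀ i, φ (genB g i) = ψ (genB g i)) : φ = ψ := by
  refine PresentedGroup.ext fun x => ?_
  rcases x with i | i
  exacts [hA i, hB i]

variable (g) in
/-- The product of the first `n` commutators `[aᵢ, bᵢ]`. -/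
def comm (n : ℕ) : SurfaceGroup g := partialProd (fun i => ⁅genA g i, genB g i⁆) n

theorem comm_self : comm g g = 1 := by
  rw [comm, partialProd_self]
  have h := PresentedGroup.one_of_mem (rels := surfaceRel g) (Set.mem_singleton _)
  rw [map_list_prod, List.map_ofFn] at h
  exact h

theorem comm_succ (i : Fin g) : comm g (i + 1) = comm g i * ⁅genA g i, genB g i⁆ :=
  partialProd_succ _ i

variable (g) in
/-- The homomorphism to a free group killing the generators `aᵢ`. -/
def toFree : SurfaceGroup g →* FreeGroup (Fin g) :=
  lift (fun _ => 1) FreeGroup.of (by simp [partialProd_self])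

@[simp]
theorem toFree_genA (i : Fin g) : toFree g (genA g i) = 1 := lift_genA _ _ _ i

@[simp]
theorem toFree_genB (i : Fin g) : toFree g (genB g i) = FreeGroup.of i := lift_genB _ _ _ i

theorem toFree_comm (n : ℕ) : toFree g (comm g n) = 1 := by
  rw [comm, map_partialProd, partialProd, List.prod_eq_one]
  intro x hx
  have := List.mem_of_mem_take hx
  simp at this
  exact this.2

variable (g) in
/-- The homomorphism from the free group sending the generators to the `bᵢ`. -/
def ofFree : FreeGroup (Fin g) →* SurfaceGroup g := FreeGroup.lift (genB g)

@[simp]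
theorem ofFree_of (i : Fin g) : ofFree g (FreeGroup.of i) = genB g i := FreeGroup.lift_apply_of

@[simp]
theorem toFree_ofFree (h : FreeGroup (Fin g)) : toFree g (ofFree g h) = h := by
  have : (toFree g).comp (ofFree g) = MonoidHom.id _ := by
    ext i
    simp
  exact DFunLike.congr_fun this h

variable (g) in
/-- The product of the inverses of the first `n` generators of a free group. -/
def boundary (n : ℕ) : FreeGroup (Fin g) := partialProd (fun i => (FreeGroup.of i)⁻¹) n

theorem boundary_zero : boundary g 0 = 1 := partialProd_zero _

theorem boundary_succ (i : Fin g) : boundary g (i + 1) = boundary g i * (FreeGroup.of i)⁻¹ :=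
  partialProd_succ _ i

variable (g) in
/-- The conjugate of a power of the boundary used in the definition of `twist`. -/
def twistCoeff (k : ℤ) (n : ℕ) : FreeGroup (Fin g) :=
  (boundary g n)⁻¹ * (boundary g g)⁻¹ ^ k * boundary g n

theorem twistCoeff_zero (k : ℤ) : twistCoeff g k 0 = (boundary g g)⁻¹ ^ k := by
  simp [twistCoeff, boundary_zero]

theorem twistCoeff_self (k : ℤ) : twistCoeff g k g = (boundary g g)⁻¹ ^ k := by
  rw [twistCoeff, mul_assoc, inv_mul_eq_iff_eq_mul]
  exact (((Commute.refl (boundary g g)).inv_right.zpow_right k).eq).symm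

theorem twistCoeff_succ (k : ℤ) (i : Fin g) :
    twistCoeff g k (i + 1) = FreeGroup.of i * twistCoeff g k i * (FreeGroup.of i)⁻¹ := by
  simp [twistCoeff, boundary_succ, mul_assoc]

theorem twistCoeff_mul (k l : ℤ) (n : ℕ) :
    twistCoeff g k n * twistCoeff g l n = twistCoeff g (k + l) n := by
  rw [twistCoeff, twistCoeff, twistCoeff, _root_.zpow_add]
  group

theorem commutator_twist (k : ℤ) (i : Fin g) :
    ⁅ofFree g (twistCoeff g k i) * genA g i * genB g i ^ k, genB g i⁆ =
      ofFree g (twistCoeff g k i) * ⁅genA g i, genB g i⁆ * (ofFree g (twistCoeff g k (i + 1)))⁻¹ := by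
  rw [twistCoeff_succ]
  simp only [map_mul, map_inv, ofFree_of, commutatorElement_def]
  group

variable (g) in
/-- A product of powers of commuting Dehn twists, as an endomorphism. -/
def twistHom (k : ℤ) : SurfaceGroup g →* SurfaceGroup g :=
  lift (fun i => ofFree g (twistCoeff g k i) * genA g i * genB g i ^ k) (genB g) (by
    rw [partialProd_telescope (fun n => ofFree g (twistCoeff g k n)) (commutator_twist k) le_rfl,
      twistCoeff_zero, twistCoeff_self]
    change _ * comm g g * _ = 1
    rw [comm_self]
    group)

@[simp]
theorem twistHom_genA (k : ℤ) (i : Fin g) :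
    twistHom g k (genA g i) = ofFree g (twistCoeff g k i) * genA g i * genB g i ^ k :=
  lift_genA _ _ _ i

@[simp]
theorem twistHom_genB (k : ℤ) (i : Fin g) : twistHom g k (genB g i) = genB g i :=
  lift_genB _ _ _ i

@[simp]
theorem twistHom_ofFree (k : ℤ) (h : FreeGroup (Fin g)) : twistHom g k (ofFree g h) = ofFree g h := by
  have : (twistHom g k).comp (ofFree g) = ofFree g := by
    ext i
    simp
  exact DFunLike.congr_fun this h

theorem twistHom_comp_neg (k : ℤ) : (twistHom g k).comp (twistHom g (-k)) = MonoidHom.id _ := by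
  refine hom_ext (fun i => ?_) fun i => by simp
  simp only [MonoidHom.comp_apply, twistHom_genA, map_mul, twistHom_ofFree, map_zpow, twistHom_genB,
    MonoidHom.id_apply]
  rw [← mul_assoc, ← mul_assoc, ← map_mul, twistCoeff_mul]
  simp [twistCoeff]

variable (g) in
/-- A product of powers of commuting Dehn twists, as an automorphism. -/
def twist (k : ℤ) : MulAut (SurfaceGroup g) :=
  MonoidHom.toMulEquiv (twistHom g k) (twistHom g (-k))
    (by simpa using twistHom_comp_neg (g := g) (-k)) (twistHom_comp_neg k)

theorem twist_apply (k : ℤ) (w : SurfaceGroup g) : twist g k w = twistHom g k w := rfl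

theorem twistHom_comm (k : ℤ) {n : ℕ} (hn : n ≤ g) :
    twistHom g k (comm g n) =
      ofFree g ((boundary g g)⁻¹ ^ k) * comm g n * (ofFree g (twistCoeff g k n))⁻¹ := by
  rw [comm, map_partialProd, ← twistCoeff_zero,
    ← partialProd_telescope (fun n => ofFree g (twistCoeff g k n)) (commutator_twist k) hn]
  congr 1
  ext i
  simp

/-- The elements crossing the twisting curves, which are indexed by `Option (Fin g)`. -/
def crossing : Option (Fin g) → SurfaceGroup g
  | none => 1
  | some i => comm g i * genA g i

/-- The classes of the twisting curves. -/
def curve : Option (Fin g) → FreeGroup (Fin g)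
  | none => boundary g g
  | some i => FreeGroup.of i

variable (g) in
/-- The other embedding of the free group, with image the fundamental group of the other side of
the twisting curves. -/
def ofFree' : FreeGroup (Fin g) →* SurfaceGroup g :=
  FreeGroup.lift fun i => crossing (some i) * genB g i * (crossing (some i))⁻¹

@[simp]
theorem ofFree'_of (i : Fin g) :
    ofFree' g (FreeGroup.of i) = crossing (some i) * genB g i * (crossing (some i))⁻¹ :=
  FreeGroup.lift_apply_of

theorem ofFree'_boundary {n : ℕ} (hn : n ≤ g) :
    ofFree' g (boundary g n) = ofFree g (boundary g n) * (comm g n)⁻¹ := by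
  induction n with
  | zero => simp [boundary_zero, comm]
  | succ n ih =>
    have h1 := boundary_succ (⟨n, hn⟩ : Fin g)
    have h2 := comm_succ (⟨n, hn⟩ : Fin g)
    dsimp only at h1 h2
    rw [h1, h2, map_mul, map_mul, ih (by omega)]
    simp only [map_inv, ofFree'_of, ofFree_of, crossing, commutatorElement_def]
    group

theorem ofFree'_curve (e : Option (Fin g)) :
    ofFree' g (curve e) = crossing e * ofFree g (curve e) * (crossing e)⁻¹ := by
  cases e with
  | none => simp [curve, crossing, ofFree'_boundary le_rfl, comm_self]
  | some i => simp [curve]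

theorem twistHom_crossing (k : ℤ) (e : Option (Fin g)) :
    twistHom g k (crossing e) =
      ofFree g ((boundary g g)⁻¹ ^ k) * crossing e * ofFree g (curve e) ^ k := by
  cases e with
  | none => simp [crossing, curve]
  | some i =>
    simp only [crossing, curve, map_mul, twistHom_comm k i.2.le, twistHom_genA, ofFree_of]
    group

@[simp]
theorem toFree_crossing (e : Option (Fin g)) : toFree g (crossing e) = 1 := by
  cases e <;> simp [crossing, toFree_comm]

theorem toFree_twistHom_crossing (k : ℤ) (e : Option (Fin g)) :
    toFree g (twistHom g k (crossing e)) = (boundary g g)⁻¹ ^ k * curve e ^ k := by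
  simp [twistHom_crossing]

theorem toFree_twistHom_ofFree' (k : ℤ) (h : FreeGroup (Fin g)) :
    toFree g (twistHom g k (ofFree' g h)) =
      (boundary g g)⁻¹ ^ k * h * ((boundary g g)⁻¹ ^ k)⁻¹ := by
  have : ((toFree g).comp (twistHom g k)).comp (ofFree' g) =
      (MulAut.conj ((boundary g g)⁻¹ ^ k)).toMonoidHom := by
    ext i
    simp only [MonoidHom.comp_apply, ofFree'_of, map_mul, map_inv, toFree_twistHom_crossing,
      twistHom_genB, toFree_genB, curve]
    change _ = (boundary g g)⁻¹ ^ k * FreeGroup.of i * ((boundary g g)⁻¹ ^ k)⁻¹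
    group
  exact DFunLike.congr_fun this h

/-- The fundamental groups of the two sides of the twisting curves. -/
def side (s : Bool) : FreeGroup (Fin g) →* SurfaceGroup g := if s then ofFree g else ofFree' g

theorem side_mul_crossing (s : Bool) (e : Option (Fin g)) (j : ℤ) :
    signed (!s) (crossing e) * side (!s) (curve e ^ j) * signed s (crossing e) =
      side s (curve e ^ j) := by
  cases s <;> simp [side, signed, ofFree'_curve]
  group

/-- The product of a path of elements alternating between the two sides, starting at the
side `s`. -/
def pathProd : Bool → List (FreeGroup (Fin g) × Option (Fin g)) → SurfaceGroup g
  | _, [] => 1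
  | s, x :: l => side s x.1 * signed (!s) (crossing x.2) * pathProd (!s) l

/-- The signed letters of a path alternating between the two sides. -/
def pathLetters :
    Bool → List (FreeGroup (Fin g) × Option (Fin g)) → List (FreeGroup (Fin g) × Option (Fin g) × Bool)
  | _, [] => []
  | s, x :: l => (x.1, x.2, !s) :: pathLetters (!s) l

/-- The side where a path of length `n` starting at the side `s` ends. -/
def endSide (s : Bool) (n : ℕ) : Bool := xor s (n.bodd)

theorem endSide_of_even (s : Bool) {n : ℕ} (h : Even n) : endSide s n = s := by
  obtain ⟨k, rfl⟩ := h
  simp [endSide]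

theorem endSide_succ (s : Bool) (n : ℕ) : endSide s (n + 1) = endSide (!s) n := by
  simp [endSide]

theorem pathProd_append (s : Bool) (l l' : List (FreeGroup (Fin g) × Option (Fin g))) :
    pathProd s (l ++ l') = pathProd s l * pathProd (endSide s l.length) l' := by
  induction l generalizing s with
  | nil => simp [pathProd, endSide]
  | cons x l ih => simp [pathProd, ih, mul_assoc, endSide_succ]

theorem pathLetters_append (s : Bool) (l l' : List (FreeGroup (Fin g) × Option (Fin g))) :
    pathLetters s (l ++ l') = pathLetters s l ++ pathLetters (endSide s l.length) l' := by
  induction l generalizing s with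
  | nil => simp [pathLetters, endSide]
  | cons x l ih => simp [pathLetters, ih, endSide_succ]

theorem isChain_pathLetters {R : FreeGroup (Fin g) × Option (Fin g) → _ → Prop}
    {R' : FreeGroup (Fin g) × Option (Fin g) × Bool → _ → Prop}
    (h : ∀ x y, R x y → ∀ s t, R' (x.1, x.2, s) (y.1, y.2, t))
    {l : List (FreeGroup (Fin g) × Option (Fin g))} (hl : l.IsChain R) (s : Bool) :
    (pathLetters s l).IsChain R' := by
  induction l generalizing s with
  | nil => simp [pathLetters]
  | cons x l ih =>
    rcases l with _ | ⟨y, l⟩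
    · simp [pathLetters]
    · rw [List.isChain_cons_cons] at hl
      exact List.isChain_cons_cons.2 ⟨h _ _ hl.1 _ _, ih hl.2 _⟩

theorem toFree_twistHom_pathProd (k : ℕ) (s : Bool) (l : List (FreeGroup (Fin g) × Option (Fin g))) :
    toFree g (twistHom g k (pathProd s l)) =
      (if s then 1 else (boundary g g)⁻¹ ^ k) *
        ((pathLetters s l).map fun x => x.1 * signed x.2.2 (curve x.2.1) ^ k).prod *
        (if endSide s l.length then 1 else (boundary g g)⁻¹ ^ k)⁻¹ := by
  induction l generalizing s with
  | nil => simp [pathProd, pathLetters, endSide]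
  | cons x l ih =>
    simp only [pathProd, map_mul, ih, pathLetters, List.map_cons, List.prod_cons, List.length_cons,
      endSide_succ]
    have h : toFree g (twistHom g k (side s x.1)) *
        toFree g (twistHom g k (signed (!s) (crossing x.2))) *
        (if !s then 1 else (boundary g g)⁻¹ ^ k) =
        (if s then 1 else (boundary g g)⁻¹ ^ k) * (x.1 * signed (!s) (curve x.2) ^ k) := by
      cases s
      · simp [side, signed, toFree_twistHom_ofFree', toFree_twistHom_crossing, mul_assoc]
      · simp [side, signed, toFree_twistHom_crossing, mul_assoc]
    rw [← mul_assoc, ← mul_assoc, h]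
    simp only [mul_assoc]

theorem isConj_toFree_twistHom_pathProd (k : ℕ) (s : Bool)
    (l : List (FreeGroup (Fin g) × Option (Fin g))) (hl : Even l.length) :
    IsConj (toFree g (twistHom g k (pathProd s l)))
      ((pathLetters s l).map fun x => x.1 * signed x.2.2 (curve x.2.1) ^ k).prod := by
  rw [toFree_twistHom_pathProd, endSide_of_even s hl]
  exact (isConj_iff.2 ⟨_, rfl⟩).symm

theorem exists_pathProd_eq (w : SurfaceGroup g) :
    ∃ l : List (FreeGroup (Fin g) × Option (Fin g)), Even l.length ∧ w = pathProd true l := by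
  have hw : w ∈ Subgroup.closure (Set.range (PresentedGroup.of (rels := surfaceRel g))) := by
    rw [PresentedGroup.closure_range_of]
    trivial
  let P : Submonoid (SurfaceGroup g) :=
    { carrier := {w | ∃ l : List (FreeGroup (Fin g) × Option (Fin g)),
        Even l.length ∧ w = pathProd true l}
      one_mem' := ⟨[], by simp, rfl⟩
      mul_mem' := by
        rintro _ _ ⟨l, hl, rfl⟩ ⟨l', hl', rfl⟩
        refine ⟨l ++ l', by simpa using hl.add hl', ?_⟩
        rw [pathProd_append, endSide_of_even _ hl] }
  have hofFree (h : FreeGroup (Fin g)) : ofFree g h ∈ P :=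
    ⟨[(h, none), (1, none)], by simp, by simp [pathProd, side, signed, crossing]⟩
  have hofFree' (h : FreeGroup (Fin g)) : ofFree' g h ∈ P :=
    ⟨[(1, none), (h, none)], by simp, by simp [pathProd, side, signed, crossing]⟩
  have hcrossing (e : Option (Fin g)) : crossing e ∈ P :=
    ⟨[(1, none), (1, e)], by simp, by simp [pathProd, side, signed, crossing]⟩
  have hcrossing' (e : Option (Fin g)) : (crossing e)⁻¹ ∈ P :=
    ⟨[(1, e), (1, none)], by simp, by simp [pathProd, side, signed, crossing]⟩
  have hcomm (i : Fin g) : comm g i = ofFree' g (boundary g i)⁻¹ * ofFree g (boundary g i) := by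
    rw [map_inv, ofFree'_boundary i.2.le]
    group
  have hA (i : Fin g) : genA g i = ofFree g (boundary g i)⁻¹ * ofFree' g (boundary g i) *
      crossing (some i) := by
    rw [crossing, hcomm]
    simp only [map_inv]
    group
  have hA' (i : Fin g) : (genA g i)⁻¹ = (crossing (some i))⁻¹ * ofFree' g (boundary g i)⁻¹ *
      ofFree g (boundary g i) := by
    rw [hA]
    simp only [map_inv]
    group
  have hgen (x : Fin g ⊕ Fin g) : PresentedGroup.of x ∈ P ∧ (PresentedGroup.of x)⁻¹ ∈ P := by
    rcases x with i | i
    · change genA g i ∈ P ∧ (genA g i)⁻¹ ∈ P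
      rw [hA', hA]
      exact ⟨P.mul_mem (P.mul_mem (hofFree _) (hofFree' _)) (hcrossing _),
        P.mul_mem (P.mul_mem (hcrossing' _) (hofFree' _)) (hofFree _)⟩
    · change genB g i ∈ P ∧ (genB g i)⁻¹ ∈ P
      rw [← ofFree_of, ← map_inv]
      exact ⟨hofFree _, hofFree _⟩
  change w ∈ P
  induction hw using Subgroup.closure_induction_left with
  | one => exact P.one_mem
  | mul_left x hx y _ ih =>
    obtain ⟨i, rfl⟩ := hx
    exact P.mul_mem (hgen i).1 ih
  | inv_mul_cancel x hx y _ ih =>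
    obtain ⟨i, rfl⟩ := hx
    exact P.mul_mem (hgen i).2 ih

theorem isConj_side_or_exists_pathProd (w : SurfaceGroup g) :
    (∃ s h, IsConj w (side s h)) ∨ ∃ s a l, Even (a :: l).length ∧ IsConj w (pathProd s (a :: l)) ∧
      List.IsChain (fun x y => ¬ (x.2 = y.2 ∧ y.1 ∈ Subgroup.zpowers (curve x.2)))
        (a :: (l ++ [a])) := by
  obtain ⟨l, hl, rfl⟩ := exists_pathProd_eq w
  have := exists_isChain_cyclic
    (R := fun l' => Even l'.length ∧ ∃ s, IsConj (pathProd true l) (pathProd s l'))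
    (Bad := fun x y => x.2 = y.2 ∧ y.1 ∈ Subgroup.zpowers (curve x.2))
    (V := ∃ s h, IsConj (pathProd true l) (side s h))
    (fun h => ⟨true, 1, by
      obtain ⟨_, s, h⟩ := h
      simpa [pathProd] using h⟩)
    (fun x l' ⟨h1, s, h2⟩ => ⟨by simpa using h1, !s, h2.trans (isConj_iff.2
      ⟨(side s x.1 * signed (!s) (crossing x.2))⁻¹, by
        rw [pathProd_append, ← endSide_succ, ← List.length_cons (a := x), endSide_of_even s h1]
        simp [pathProd, mul_assoc]⟩)⟩)
    ?_ (fun x h _ => by simp at h) l ⟨hl, true, IsConj.refl _⟩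
  · rcases this with h | ⟨a, l', ⟨h1, s, h2⟩, h3⟩
    · exact Or.inl h
    · exact Or.inr ⟨s, a, l', h1, h2, h3⟩
  rintro ⟨h₁, e⟩ ⟨h₂, e'⟩ l' ⟨h1, s, h2⟩ ⟨h3, j, h4⟩
  dsimp only at h3 h4
  subst h3 h4
  have h5 : pathProd s ((h₁, e) :: (curve e ^ j, e) :: l') =
      side s (h₁ * curve e ^ j) * pathProd s l' := by
    simp only [pathProd, Bool.not_not]
    rw [map_mul, ← side_mul_crossing s e j]
    simp only [mul_assoc]
  rw [h5] at h2
  rcases l' with _ | ⟨y, l'⟩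
  · exact Or.inl ⟨s, _, by simpa only [pathProd, mul_one] using h2⟩
  · refine Or.inr ⟨(h₁ * curve e ^ j * y.1, y.2) :: l', by simp, ?_, s, ?_⟩
    · simpa [Nat.even_add_one] using h1
    · simpa only [pathProd, map_mul, mul_assoc] using h2

theorem boundary_weight (v : Fin g → ℤ) :
    (FreeGroup.weight v (boundary g g)).toAdd = -∑ i, v i := by
  rw [boundary, map_partialProd, partialProd_self, List.prod_ofFn, toAdd_prod]
  simp

theorem exists_weight_curve (hg : 2 ≤ g) (e : Option (Fin g)) :
    ∃ v : Fin g → ℤ, (FreeGroup.weight v (curve e)).toAdd = 1 := by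
  cases e with
  | none => exact ⟨Pi.single ⟨0, by omega⟩ (-1), by simp [curve, boundary_weight]⟩
  | some i => exact ⟨Pi.single i 1, by simp [curve]⟩

theorem curve_ne_one (hg : 2 ≤ g) (e : Option (Fin g)) : curve e ≠ 1 := by
  obtain ⟨v, hv⟩ := exists_weight_curve hg e
  intro h
  simp [h] at hv

theorem exists_weight_curve_of_ne (hg : 2 ≤ g) {e e' : Option (Fin g)} (h : e ≠ e') :
    ∃ v : Fin g → ℤ, FreeGroup.weight v (curve e) ≠ 1 ∧ FreeGroup.weight v (curve e') = 1 := by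
  have : Nontrivial (Fin g) := Fin.nontrivial_iff_two_le.2 hg
  have hto (x : Multiplicative ℤ) : x = 1 ↔ x.toAdd = 0 := toAdd_eq_zero.symm
  simp only [ne_eq, hto]
  rcases e with _ | i <;> rcases e' with _ | j
  · exact absurd rfl h
  · obtain ⟨k, hk⟩ := exists_ne j
    exact ⟨Pi.single k 1, by simp [curve, boundary_weight], by simp [curve, hk.symm]⟩
  · obtain ⟨k, hk⟩ := exists_ne i
    exact ⟨Pi.single i 1 - Pi.single k 1, by simp [curve, hk.symm], by simp [curve, boundary_weight]⟩
  · have hij : j ≠ i := fun h' => h (congrArg some h'.symm)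
    exact ⟨Pi.single i 1, by simp [curve], by simp [curve, hij]⟩

theorem commutator_curve_ne_one (hg : 2 ≤ g) {e e' : Option (Fin g)} {h : FreeGroup (Fin g)}
    (hh : ¬ (e = e' ∧ h ∈ Subgroup.zpowers (curve e))) : ⁅curve e, h * curve e' * h⁻¹⁆ ≠ 1 := by
  rw [ne_eq, commutatorElement_eq_one_iff_commute]
  by_cases hee : e = e'
  · subst hee
    obtain ⟨v, hv⟩ := exists_weight_curve hg e
    exact fun hc => hh ⟨rfl, FreeGroup.mem_zpowers_of_commute_conj _ hv hc⟩
  · obtain ⟨v, hv, hv'⟩ := exists_weight_curve_of_ne hg hee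
    exact FreeGroup.not_commute_conj _ hv hv' (curve_ne_one hg e')

theorem exists_eventually_isLoxodromic_twistHom (hg : 2 ≤ g) {w : SurfaceGroup g} (hw : w ≠ 1) :
    ∃ T : Set (FreeGroup (Fin g)), T.Finite ∧ 1 ∉ T ∧
      ∀ θ : FreeGroup (Fin g) →* SpecialLinearGroup (Fin 2) ℝ, (∀ h ∈ T, IsLoxodromic (θ h)) →
        ∀ᶠ k : ℕ in atTop, IsLoxodromic (θ (toFree g (twistHom g k w))) := by
  rcases isConj_side_or_exists_pathProd w with ⟨s, h, hR⟩ | ⟨s, a, l, hev, hR, hc⟩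
  · refine ⟨{h}, by simp, ?_, fun θ hθ => Eventually.of_forall fun k =>
      IsLoxodromic.of_isConj ((θ.comp ((toFree g).comp (twistHom g k))).map_isConj hR) ?_⟩
    · rintro rfl
      rw [map_one] at hR
      exact hw (isConj_one_left.1 hR)
    · have h1 : IsConj (toFree g (twistHom g k (side s h))) h := by
        cases s
        · exact (isConj_iff.2 ⟨_, (toFree_twistHom_ofFree' k h).symm⟩).symm
        · rw [side, if_pos rfl, twistHom_ofFree, toFree_ofFree]
      exact IsLoxodromic.of_isConj (θ.map_isConj h1) (hθ h rfl)
  have hfin : {z : (FreeGroup (Fin g) × Option (Fin g)) × (FreeGroup (Fin g) × Option (Fin g)) |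
      z.1 ∈ a :: l ∧ z.2 ∈ a :: l}.Finite :=
    (a :: l).finite_toSet.prod (a :: l).finite_toSet
  refine ⟨Set.range curve ∪ (((fun z => ⁅curve z.1.2, z.2.1 * curve z.2.2 * z.2.1⁻¹⁆) ''
      {z : (FreeGroup (Fin g) × Option (Fin g)) × (FreeGroup (Fin g) × Option (Fin g)) |
      z.1 ∈ a :: l ∧ z.2 ∈ a :: l}) \ {1}),
    (Set.finite_range _).union ((hfin.image _).sdiff), ?_, fun θ hθ => ?_⟩
  · rintro (⟨e, he⟩ | ⟨_, h1⟩)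
    · exact curve_ne_one hg e he
    · exact h1 rfl
  have E (e : Option (Fin g)) : Eigensystem (θ (curve e)).1 :=
    (hθ (curve e) (Or.inl ⟨e, rfl⟩)).nonempty_eigensystem.some
  have h1 := isChain_pathLetters (R' := fun x y => (E x.2.1).f x.2.2 ⬝ᵥ
      ((θ y.1).1 *ᵥ (E y.2.1).v y.2.2) ≠ 0) (fun _ _ h s t => h s t)
    (hc.imp_of_mem_imp (S := fun x y => ∀ s t, (E x.2).f s ⬝ᵥ ((θ y.1).1 *ᵥ (E y.2).v t) ≠ 0)
      fun x y hx hy hxy s t => by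
        refine dotProduct_mulVec_ne_zero (E x.2) (E y.2) ?_ _ _
        have hx' : x ∈ a :: l := by simpa [or_comm, or_assoc] using hx
        have hy' : y ∈ a :: l := by simpa [or_comm, or_assoc] using hy
        have h2 := hθ ⁅curve x.2, y.1 * curve y.2 * y.1⁻¹⁆
          (Or.inr ⟨⟨(x, y), ⟨hx', hy'⟩, rfl⟩, commutator_curve_ne_one hg hxy⟩)
        simpa [map_commutatorElement] using h2) s
  have h2 := List.isChain_map_of_isChain (S := fun (x y : SpecialLinearGroup (Fin 2) ℝ ×
      Option (Fin g) × Bool) => (E x.2.1).f x.2.2 ⬝ᵥ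
      (y.1.1 *ᵥ (E y.2.1).v y.2.2) ≠ 0)
    (fun x : FreeGroup (Fin g) × Option (Fin g) × Bool => (θ x.1, x.2)) (fun _ _ h => h) h1
  rw [← List.cons_append, pathLetters_append, endSide_of_even _ hev] at h2
  have h3 := eventually_isLoxodromic_prod E (θ a.1, a.2, !s)
    ((pathLetters (!s) l).map fun x => (θ x.1, x.2)) (by simpa [pathLetters] using h2)
  filter_upwards [h3] with k hk
  refine IsLoxodromic.of_isConj (θ.map_isConj
    ((((toFree g).comp (twistHom g k)).map_isConj hR).trans
      (isConj_toFree_twistHom_pathProd k s _ hev))) ?_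
  rw [map_list_prod, List.map_map]
  rw [← List.map_cons (f := fun x : FreeGroup (Fin g) × Option (Fin g) × Bool => (θ x.1, x.2))
    (a := (a.1, a.2, !s)), List.map_map] at hk
  refine (congrArg (fun w : List _ => IsLoxodromic w.prod) ?_).mp hk
  refine List.map_congr_left fun x _ => ?_
  simp only [Function.comp, map_mul, map_pow, map_signed]

end SurfaceGroup

theorem partialProd_of_agree {G : Type*} [Group G] {m : ℕ} {r r' : Fin (m + 1) → G} {j : Fin m}
    (h : ∀ i, i ≠ j.castSucc → i ≠ Fin.last m → r' i = r i) {n : ℕ} (hj : j < n) (hn : n ≤ m) :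
    partialProd r' n =
      partialProd r j * r' j.castSucc * (partialProd r (j + 1))⁻¹ * partialProd r n := by
  have h1 : ∀ n : ℕ, n ≤ j → partialProd r' n = partialProd r n := by
    intro n hn
    induction n with
    | zero => simp
    | succ n ih =>
      have hnj : n < j := hn
      have hjm := j.2
      rw [partialProd_succ r' ⟨n, by omega⟩, partialProd_succ r ⟨n, by omega⟩, ih (by omega),
        h ⟨n, by omega⟩ (by simp [Fin.ext_iff]; omega) (by simp [Fin.ext_iff]; omega)]
  induction n, hj using Nat.le_induction with
  | base =>
    have := partialProd_succ r' j.castSucc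
    rw [Fin.val_castSucc] at this
    rw [Nat.succ_eq_add_one, this, h1 _ le_rfl]
    group
  | succ n hjn ih =>
    have hjn' : j < n := hjn
    rw [partialProd_succ r' ⟨n, by omega⟩, partialProd_succ r ⟨n, by omega⟩, ih (by omega),
      h ⟨n, by omega⟩ (by simp [Fin.ext_iff]; omega) (by simp [Fin.ext_iff]; omega)]
    simp only [mul_assoc]

namespace FreeGroup

variable {m : ℕ}

/-- The endomorphism multiplying the last generator by `V` on the right. -/
def lastMul (V : FreeGroup (Fin m)) : FreeGroup (Fin (m + 1)) →* FreeGroup (Fin (m + 1)) :=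
  lift (Fin.lastCases (of (Fin.last m) * map Fin.castSucc V) fun i => of i.castSucc)

@[simp]
theorem lastMul_of_last (V : FreeGroup (Fin m)) :
    lastMul V (of (Fin.last m)) = of (Fin.last m) * map Fin.castSucc V := by
  simp [lastMul]

@[simp]
theorem lastMul_of_castSucc (V : FreeGroup (Fin m)) (i : Fin m) :
    lastMul V (of i.castSucc) = of i.castSucc := by
  simp [lastMul]

@[simp]
theorem lastMul_map_castSucc (V h : FreeGroup (Fin m)) :
    lastMul V (map Fin.castSucc h) = map Fin.castSucc h := by
  have : (lastMul V).comp (map Fin.castSucc) = map Fin.castSucc := by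
    ext i
    simp
  exact DFunLike.congr_fun this h

theorem lastMul_comp (V V' : FreeGroup (Fin m)) :
    (lastMul V).comp (lastMul V') = lastMul (V * V') := by
  ext i
  cases i using Fin.lastCases <;> simp [mul_assoc]

theorem lastMul_one : lastMul (1 : FreeGroup (Fin m)) = MonoidHom.id _ := by
  ext i
  cases i using Fin.lastCases <;> simp

theorem lastTo_comp_lastMul (V : FreeGroup (Fin m)) : (lastTo 1).comp (lastMul V) = lastTo V := by
  ext i
  cases i using Fin.lastCases <;> simp

end FreeGroup

namespace SurfaceGroup

variable {m : ℕ}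

/-- The product of the commutators strictly between the `j`-th and the last one. -/
def between (j : Fin m) : SurfaceGroup (m + 1) := (comm (m + 1) (j + 1))⁻¹ * comm (m + 1) m

theorem between_relation (j : Fin m) :
    comm (m + 1) j * ⁅genA (m + 1) j.castSucc, genB (m + 1) j.castSucc⁆ * between j *
      ⁅genA (m + 1) (Fin.last m), genB (m + 1) (Fin.last m)⁆ = 1 := by
  have h1 := comm_succ j.castSucc
  have h2 := comm_succ (Fin.last m)
  rw [Fin.val_castSucc] at h1
  rw [Fin.val_last, comm_self] at h2
  rw [between, ← h1, h2]
  group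

/-- The endomorphism changing only the images of `aⱼ`, `bⱼ` and of the last two generators. -/
def replace (j : Fin m) (a b s t : SurfaceGroup (m + 1))
    (h : comm (m + 1) j * ⁅a, b⁆ * between j * ⁅s, t⁆ = 1) :
    SurfaceGroup (m + 1) →* SurfaceGroup (m + 1) :=
  lift (Function.update (Function.update (genA (m + 1)) j.castSucc a) (Fin.last m) s)
    (Function.update (Function.update (genB (m + 1)) j.castSucc b) (Fin.last m) t) (by
      have hj : j.castSucc ≠ Fin.last m := (Fin.castSucc_lt_last j).ne
      have h1 := fun r : Fin (m + 1) → SurfaceGroup (m + 1) => partialProd_succ r (Fin.last m)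
      simp only [Fin.val_last] at h1
      rw [h1, partialProd_of_agree (r := fun i => ⁅genA (m + 1) i, genB (m + 1) i⁆) (j := j)
        (fun i hi hi' => by simp [hi, hi']) j.2 le_rfl]
      rw [between] at h
      simpa [hj, comm, mul_assoc] using h)

section replace

variable (j : Fin m) (a b s t : SurfaceGroup (m + 1))
    (h : comm (m + 1) j * ⁅a, b⁆ * between j * ⁅s, t⁆ = 1)

@[simp]
theorem replace_genA_castSucc : replace j a b s t h (genA (m + 1) j.castSucc) = a := by
  simp [replace, (Fin.castSucc_lt_last j).ne]

@[simp]
theorem replace_genB_castSucc : replace j a b s t h (genB (m + 1) j.castSucc) = b := by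
  simp [replace, (Fin.castSucc_lt_last j).ne]

@[simp]
theorem replace_genA_last : replace j a b s t h (genA (m + 1) (Fin.last m)) = s := by
  simp [replace]

@[simp]
theorem replace_genB_last : replace j a b s t h (genB (m + 1) (Fin.last m)) = t := by
  simp [replace]

theorem replace_genA {i : Fin (m + 1)} (hi : i ≠ j.castSucc) (hi' : i ≠ Fin.last m) :
    replace j a b s t h (genA (m + 1) i) = genA (m + 1) i := by
  simp [replace, hi, hi']

theorem replace_genB {i : Fin (m + 1)} (hi : i ≠ j.castSucc) (hi' : i ≠ Fin.last m) :
    replace j a b s t h (genB (m + 1) i) = genB (m + 1) i := by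
  simp [replace, hi, hi']

@[simp]
theorem replace_between : replace j a b s t h (between j) = between j := by
  have key {n : ℕ} (hj : j < n) (hn : n ≤ m) := partialProd_of_agree
    (r := fun i => ⁅genA (m + 1) i, genB (m + 1) i⁆)
    (r' := fun i => replace j a b s t h ⁅genA (m + 1) i, genB (m + 1) i⁆) (j := j)
    (fun i hi hi' => by
      rw [map_commutatorElement, replace_genA j a b s t h hi hi', replace_genB j a b s t h hi hi'])
    hj hn
  rw [between, map_mul, map_inv, comm, comm, map_partialProd, map_partialProd,
    key (Nat.lt_succ_self _) j.2, key j.2 le_rfl]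
  group

end replace

theorem hom_ext_of_castSucc_last (j : Fin m) {G : Type*} [Group G]
    {φ ψ : SurfaceGroup (m + 1) →* G}
    (h : ∀ i, i ≠ j.castSucc → i ≠ Fin.last m →
      φ (genA (m + 1) i) = ψ (genA (m + 1) i) ∧ φ (genB (m + 1) i) = ψ (genB (m + 1) i))
    (hA : φ (genA (m + 1) j.castSucc) = ψ (genA (m + 1) j.castSucc))
    (hB : φ (genB (m + 1) j.castSucc) = ψ (genB (m + 1) j.castSucc))
    (hA' : φ (genA (m + 1) (Fin.last m)) = ψ (genA (m + 1) (Fin.last m)))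
    (hB' : φ (genB (m + 1) (Fin.last m)) = ψ (genB (m + 1) (Fin.last m))) : φ = ψ := by
  refine hom_ext (fun i => ?_) fun i => ?_ <;> by_cases h1 : i = j.castSucc
  · rwa [h1]
  · by_cases h2 : i = Fin.last m
    · rwa [h2]
    · exact (h i h1 h2).1
  · rwa [h1]
  · by_cases h2 : i = Fin.last m
    · rwa [h2]
    · exact (h i h1 h2).2

section slide

variable (j : Fin m)

/-- The loop `bⱼ`, based at the last handle. -/
def slideLoop : SurfaceGroup (m + 1) := (between j)⁻¹ * genB (m + 1) j.castSucc * between j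

/-- The endomorphism sliding a foot of the last handle around `bⱼ`. -/
def slideHom : SurfaceGroup (m + 1) →* SurfaceGroup (m + 1) :=
  replace j
    (genA (m + 1) j.castSucc * (between j * ((slideLoop j)⁻¹ * genA (m + 1) (Fin.last m) *
      slideLoop j) * (between j)⁻¹)⁻¹)
    (between j * ((slideLoop j)⁻¹ * genA (m + 1) (Fin.last m) * slideLoop j) * (between j)⁻¹ *
      genB (m + 1) j.castSucc * (between j * ((slideLoop j)⁻¹ * genA (m + 1) (Fin.last m) *
      slideLoop j) * (between j)⁻¹)⁻¹)
    ((slideLoop j)⁻¹ * genA (m + 1) (Fin.last m) * slideLoop j)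
    (genB (m + 1) (Fin.last m) * slideLoop j) (by
      rw [← between_relation j]
      simp only [slideLoop, commutatorElement_def]
      group)

/-- The inverse of `slideHom`. -/
def slideInv : SurfaceGroup (m + 1) →* SurfaceGroup (m + 1) :=
  replace j
    (genA (m + 1) j.castSucc * (between j * genA (m + 1) (Fin.last m) * (between j)⁻¹))
    ((between j * genA (m + 1) (Fin.last m) * (between j)⁻¹)⁻¹ * genB (m + 1) j.castSucc *
      (between j * genA (m + 1) (Fin.last m) * (between j)⁻¹))
    ((genA (m + 1) (Fin.last m))⁻¹ * slideLoop j * genA (m + 1) (Fin.last m) * (slideLoop j)⁻¹ *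
      genA (m + 1) (Fin.last m))
    (genB (m + 1) (Fin.last m) * ((genA (m + 1) (Fin.last m))⁻¹ * (slideLoop j)⁻¹ *
      genA (m + 1) (Fin.last m))) (by
      rw [← between_relation j]
      simp only [slideLoop, commutatorElement_def]
      group)

theorem slideHom_comp_slideInv : (slideHom j).comp (slideInv j) = MonoidHom.id _ := by
  refine hom_ext_of_castSucc_last j (fun i h1 h2 => ?_) ?_ ?_ ?_ ?_
  · simp [slideHom, slideInv, replace_genA _ _ _ _ _ _ h1 h2, replace_genB _ _ _ _ _ _ h1 h2]
  all_goals
    simp only [slideHom, slideInv, MonoidHom.comp_apply, replace_genA_castSucc,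
      replace_genB_castSucc, replace_genA_last, replace_genB_last, map_mul, map_inv,
      replace_between, slideLoop, MonoidHom.id_apply]
    group

theorem slideInv_comp_slideHom : (slideInv j).comp (slideHom j) = MonoidHom.id _ := by
  refine hom_ext_of_castSucc_last j (fun i h1 h2 => ?_) ?_ ?_ ?_ ?_
  · simp [slideHom, slideInv, replace_genA _ _ _ _ _ _ h1 h2, replace_genB _ _ _ _ _ _ h1 h2]
  all_goals
    simp only [slideHom, slideInv, MonoidHom.comp_apply, replace_genA_castSucc,
      replace_genB_castSucc, replace_genA_last, replace_genB_last, map_mul, map_inv,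
      replace_between, slideLoop, MonoidHom.id_apply]
    group

/-- The automorphism sliding a foot of the last handle around `bⱼ`. -/
def slide : MulAut (SurfaceGroup (m + 1)) :=
  MonoidHom.toMulEquiv (slideHom j) (slideInv j) (slideInv_comp_slideHom j)
    (slideHom_comp_slideInv j)

theorem toFree_slide (w : SurfaceGroup (m + 1)) :
    toFree (m + 1) (slide j w) = FreeGroup.lastMul (FreeGroup.of j) (toFree (m + 1) w) := by
  have hb : toFree (m + 1) (between j) = 1 := by simp [between, toFree_comm]
  have : (toFree (m + 1)).comp (slideHom j) =
      (FreeGroup.lastMul (FreeGroup.of j)).comp (toFree (m + 1)) := by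
    refine hom_ext_of_castSucc_last j (fun i h1 h2 => ?_) ?_ ?_ ?_ ?_
    · obtain ⟨i, rfl⟩ := Fin.exists_castSucc_eq.2 h2
      simp [slideHom, replace_genA _ _ _ _ _ _ h1 h2, replace_genB _ _ _ _ _ _ h1 h2]
    all_goals simp [slideHom, slideLoop, hb]
  exact DFunLike.congr_fun this w

end slide

theorem exists_mulAut_toFree_eq_lastMul (V : FreeGroup (Fin m)) :
    ∃ β : MulAut (SurfaceGroup (m + 1)), ∀ w,
      toFree (m + 1) (β w) = FreeGroup.lastMul V (toFree (m + 1) w) := by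
  induction V using FreeGroup.induction_on with
  | C1 => exact ⟨1, fun w => by simp [FreeGroup.lastMul_one]⟩
  | of j => exact ⟨slide j, toFree_slide j⟩
  | inv_of j ih =>
    obtain ⟨β, hβ⟩ := ih
    refine ⟨β⁻¹, fun w => ?_⟩
    obtain ⟨w, rfl⟩ := β.surjective w
    rw [hβ, ← MonoidHom.comp_apply, FreeGroup.lastMul_comp, inv_mul_cancel, FreeGroup.lastMul_one]
    simp
  | mul V V' ih ih' =>
    obtain ⟨β, hβ⟩ := ih
    obtain ⟨β', hβ'⟩ := ih'
    exact ⟨β * β', fun w => by rw [MulAut.mul_apply, hβ, hβ', ← FreeGroup.lastMul_comp]; rfl⟩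

theorem finite_cayleyBall (g n : ℕ) : (cayleyBall g n).Finite := by
  have hgen : (surfaceGens g).Finite := by
    refine (((Set.finite_range (genA g)).union (Set.finite_range (genB g))).union
      ((Set.finite_range fun i => (genA g i)⁻¹).union
        (Set.finite_range fun i => (genB g i)⁻¹))).subset ?_
    rintro x ⟨i, rfl | rfl | rfl | rfl⟩ <;> simp
  have : Finite (surfaceGens g) := hgen
  refine ((List.finite_length_le (surfaceGens g) n).image fun l => (l.map Subtype.val).prod).subset
    ?_
  rintro x ⟨l, h1, h2, rfl⟩
  lift l to List (surfaceGens g) using h2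
  exact ⟨l, by simpa using h1, rfl⟩

theorem exists_mulAut_forall_ne_one (hm : 2 ≤ m) {S : Set (SurfaceGroup (m + 1))} (hS : S.Finite)
    (e : SurfaceGroup (m + 1) →* SurfaceGroup m)
    (hA : ∀ i : Fin m, e (genA (m + 1) i.castSucc) = genA m i)
    (hB : ∀ i : Fin m, e (genB (m + 1) i.castSucc) = genB m i)
    (hA' : e (genA (m + 1) (Fin.last m)) = 1) (hB' : e (genB (m + 1) (Fin.last m)) = 1) :
    ∃ α : MulAut (SurfaceGroup (m + 1)), ∀ w ∈ S, w ≠ 1 → e (α w) ≠ 1 := by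
  have he : (toFree m).comp e = (FreeGroup.lastTo 1).comp (toFree (m + 1)) := by
    refine hom_ext (fun i => ?_) fun i => ?_
    · cases i using Fin.lastCases <;> simp [hA, hA']
    · cases i using Fin.lastCases <;> simp [hB, hB']
  have : Finite {w // w ∈ S ∧ w ≠ 1} := hS.subset fun _ h => h.1
  choose T hT hT1 hTθ using fun w : {w // w ∈ S ∧ w ≠ 1} =>
    exists_eventually_isLoxodromic_twistHom (by omega) w.2.2
  obtain ⟨V, θ, hθ⟩ := FreeGroup.exists_forall_isLoxodromic_lastTo hm (Set.finite_iUnion hT)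
    (by simpa using hT1)
  obtain ⟨k, hk⟩ := (eventually_all.2 fun w => hTθ w (θ.comp (FreeGroup.lastTo V))
    fun h hh => hθ h (Set.mem_iUnion.2 ⟨w, hh⟩)).exists
  obtain ⟨β, hβ⟩ := exists_mulAut_toFree_eq_lastMul V
  refine ⟨β * twist (m + 1) k, fun w hw hw1 h => (hk ⟨w, hw, hw1⟩).ne_one ?_⟩
  have h1 := DFunLike.congr_fun he ((β * twist (m + 1) k) w)
  rw [MonoidHom.comp_apply, h, map_one, MonoidHom.comp_apply, MulAut.mul_apply, hβ,
    ← MonoidHom.comp_apply, FreeGroup.lastTo_comp_lastMul, twist_apply] at h1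
  rw [MonoidHom.comp_apply, ← h1, map_one]

end SurfaceGroup

end

/-- Lemma 2.29 of the paper (`lemtechMCG3`): let `e : π₁Σ_g →* π₁Σ_{g-1}` be the
handle-collapsing homomorphism (determined on the generators by `aᵢ ↦ aᵢ`, `bᵢ ↦ bᵢ` for
`i < g − 1` and `a_{g−1} ↦ 1`, `b_{g−1} ↦ 1`). Then for every `n` there is an
automorphism `α` of `π₁Σ_g` such that `e ∘ α` kills no non-trivial element of the
ball `Bₙ`. -/
theorem handle_collapse_precompose_automorphism_almost_injective
    (g : ℕ) (hg : 3 ≤ g)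
    (e : SurfaceGroup g →* SurfaceGroup (g - 1))
    (heA : ∀ (i : Fin g) (h : (i : ℕ) < g - 1), e (genA g i) = genA (g - 1) ⟨i, h⟩)
    (heB : ∀ (i : Fin g) (h : (i : ℕ) < g - 1), e (genB g i) = genB (g - 1) ⟨i, h⟩)
    (heA' : ∀ i : Fin g, (i : ℕ) = g - 1 → e (genA g i) = 1)
    (heB' : ∀ i : Fin g, (i : ℕ) = g - 1 → e (genB g i) = 1) :
    ∀ n : ℕ, ∃ α : MulAut (SurfaceGroup g),
      ∀ w ∈ cayleyBall g n, w ≠ 1 → e (α w) ≠ 1 := by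
  intro n
  obtain ⟨m, rfl⟩ : ∃ m, g = m + 1 := ⟨g - 1, by omega⟩
  exact SurfaceGroup.exists_mulAut_forall_ne_one (by omega) (SurfaceGroup.finite_cayleyBall _ n) e
    (fun i => heA i.castSucc i.2) (fun i => heB i.castSucc i.2) (heA' _ rfl) (heB' _ rfl)
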